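/- arXiv:2402.15661 — 5 statements merged into one kernel-verified Lean document; each statement's English description precedes it below -/
import Mathlib

section
/- Let X be a separable real Banach space with Property(M). Then c₀ does not embed isomorphically into X if and only if X has weak normal structure. -/
open Filter Topology ZeroAtInfty

/-- A sequence converges weakly to zero. -/
def WeakNull {E : Type*} [NormedAddCommGroup E] [NormedSpace ℝ E] (x : ℕ → E) : Prop :=
  ∀ f : E →L[ℝ] ℝ, Tendsto (fun n => f (x n)) atTop (nhds 0)

/-- Property (M). -/
def PropertyM (E : Type*) [NormedAddCommGroup E] [NormedSpace ℝ E] : Prop :=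
  ∀ x : ℕ → E, WeakNull x → ∀ u v : E, ‖u‖ ≤ ‖v‖ →
    Filter.limsup (fun n => ‖x n + u‖) atTop ≤ Filter.limsup (fun n => ‖x n + v‖) atTop

/-- `F` embeds isomorphically into `E`. -/
def EmbedsIso (F E : Type*) [NormedAddCommGroup F] [NormedSpace ℝ F]
    [NormedAddCommGroup E] [NormedSpace ℝ E] : Prop :=
  ∃ T : F →L[ℝ] E, Function.Injective T ∧ ∃ c > (0 : ℝ), ∀ y, c * ‖y‖ ≤ ‖T y‖

/-- Weak normal structure. -/
def WeakNormalStructure (E : Type*) [NormedAddCommGroup E] [NormedSpace ℝ E] : Prop :=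
  ∀ C : Set E, Convex ℝ C → IsCompact (toWeakSpace ℝ E '' C) → C.Nontrivial →
    ∃ x ∈ C, sSup ((fun y => ‖x - y‖) '' C) < Metric.diam C

/-- Property (K). -/
def PropertyK (E : Type*) [NormedAddCommGroup E] [NormedSpace ℝ E] : Prop :=
  ∃ K : ℝ, 0 ≤ K ∧ K < 1 ∧ ∀ (x : ℕ → E) (y : E), WeakNull x →
    Tendsto (fun n => ‖x n‖) atTop (nhds 1) →
    Filter.liminf (fun n => ‖x n - y‖) atTop ≤ 1 → ‖y‖ ≤ K

/-- Kadec-Klee norm. -/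
def KadecKlee (E : Type*) [NormedAddCommGroup E] [NormedSpace ℝ E] : Prop :=
  ∀ (x : ℕ → E) (y : E),
    (∀ f : E →L[ℝ] ℝ, Tendsto (fun n => f (x n)) atTop (nhds (f y))) →
    Tendsto (fun n => ‖x n‖) atTop (nhds ‖y‖) →
    Tendsto (fun n => ‖x n - y‖) atTop (nhds 0)

/-- Opial's modulus. -/
noncomputable def opialModulus (E : Type*) [NormedAddCommGroup E] [NormedSpace ℝ E]
    (c : ℝ) : ℝ :=
  sInf { r : ℝ | ∃ (x : ℕ → E) (y : E), c ≤ ‖y‖ ∧ WeakNull x ∧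
    1 ≤ Filter.liminf (fun n => ‖x n‖) atTop ∧
    r = Filter.liminf (fun n => ‖x n - y‖) atTop - 1 }

/-- A sequence of functionals converges weak-star to zero. -/
def WeakStarNull {E : Type*} [NormedAddCommGroup E] [NormedSpace ℝ E]
    (f : ℕ → (E →L[ℝ] ℝ)) : Prop :=
  ∀ x : E, Tendsto (fun n => f n x) atTop (nhds 0)

/-- Property (M*) of the dual. -/
def PropertyMStar (E : Type*) [NormedAddCommGroup E] [NormedSpace ℝ E] : Prop :=
  ∀ f : ℕ → (E →L[ℝ] ℝ), WeakStarNull f → ∀ u v : E →L[ℝ] ℝ, ‖u‖ ≤ ‖v‖ →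
    Filter.limsup (fun n => ‖f n + u‖) atTop ≤ Filter.limsup (fun n => ‖f n + v‖) atTop

/-- Property (K*) of the dual. -/
def PropertyKStar (E : Type*) [NormedAddCommGroup E] [NormedSpace ℝ E] : Prop :=
  ∃ K : ℝ, 0 ≤ K ∧ K < 1 ∧ ∀ (f : ℕ → (E →L[ℝ] ℝ)) (g : E →L[ℝ] ℝ), WeakStarNull f →
    Tendsto (fun n => ‖f n‖) atTop (nhds 1) →
    Filter.liminf (fun n => ‖f n - g‖) atTop ≤ 1 → ‖g‖ ≤ K

/-- weak* Kadec-Klee norm on the dual. -/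
def WeakStarKadecKlee (E : Type*) [NormedAddCommGroup E] [NormedSpace ℝ E] : Prop :=
  ∀ (f : ℕ → (E →L[ℝ] ℝ)) (g : E →L[ℝ] ℝ),
    (∀ x : E, Tendsto (fun n => f n x) atTop (nhds (g x))) →
    Tendsto (fun n => ‖f n‖) atTop (nhds ‖g‖) →
    Tendsto (fun n => ‖f n - g‖) atTop (nhds 0)

/-- weak* Opial modulus of the dual. -/
noncomputable def weakStarOpialModulus (E : Type*) [NormedAddCommGroup E] [NormedSpace ℝ E]
    (c : ℝ) : ℝ :=
  sInf { r : ℝ | ∃ (f : ℕ → (E →L[ℝ] ℝ)) (g : E →L[ℝ] ℝ), c ≤ ‖g‖ ∧ WeakStarNull f ∧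
    1 ≤ Filter.liminf (fun n => ‖f n‖) atTop ∧
    r = Filter.liminf (fun n => ‖f n - g‖) atTop - 1 }

/-- WORTH* for the dual. -/
def WORTHStar (E : Type*) [NormedAddCommGroup E] [NormedSpace ℝ E] : Prop :=
  ∀ f : ℕ → (E →L[ℝ] ℝ), WeakStarNull f → ∀ g : E →L[ℝ] ℝ,
    Tendsto (fun n => ‖f n - g‖ - ‖f n + g‖) atTop (nhds 0)

/-- Reflexivity of a normed space. -/
def IsReflexive (E : Type*) [NormedAddCommGroup E] [NormedSpace ℝ E] : Prop :=
  Function.Surjective (NormedSpace.inclusionInDoubleDual ℝ E)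

/-- The fixed point property for nonexpansive maps. -/
def FPP (E : Type*) [NormedAddCommGroup E] [NormedSpace ℝ E] : Prop :=
  ∀ C : Set E, C.Nonempty → IsClosed C → Bornology.IsBounded C → Convex ℝ C →
    ∀ T : E → E, Set.MapsTo T C C →
      (∀ x ∈ C, ∀ y ∈ C, ‖T x - T y‖ ≤ ‖x - y‖) → ∃ x ∈ C, T x = x

/-- `E` contains an asymptotically isometric copy of `c₀`. -/
def ContainsAsympIsoC0 (E : Type*) [NormedAddCommGroup E] [NormedSpace ℝ E] : Prop :=
  ∃ ε : ℕ → ℝ, (∀ n, ε n ∈ Set.Ioo (0 : ℝ) 1) ∧ Tendsto ε atTop (nhds 0) ∧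
    ∃ x : ℕ → E, ∀ t : ℕ →₀ ℝ,
      (∀ n, (1 - ε n) * |t n| ≤ ‖∑ n ∈ t.support, t n • x n‖) ∧
      ‖∑ n ∈ t.support, t n • x n‖ ≤ ⨆ n, |t n|

/-- `E` contains an asymptotically isometric copy of `ℓ₁`. -/
def ContainsAsympIsoL1 (E : Type*) [NormedAddCommGroup E] [NormedSpace ℝ E] : Prop :=
  ∃ ε : ℕ → ℝ, (∀ n, ε n ∈ Set.Ioo (0 : ℝ) 1) ∧ Tendsto ε atTop (nhds 0) ∧
    ∃ x : ℕ → E, ∀ t : ℕ →₀ ℝ,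
      (∑ n ∈ t.support, (1 - ε n) * |t n| ≤ ‖∑ n ∈ t.support, t n • x n‖) ∧
      ‖∑ n ∈ t.support, t n • x n‖ ≤ ∑ n ∈ t.support, |t n|



/-- A weakly null sequence in the unit ball that spans `c₀` almost isometrically far out. -/
structure IsAsymptoticC0 {E : Type*} [NormedAddCommGroup E] [NormedSpace ℝ E] (x : ℕ → E) :
    Prop where
  weakNull : WeakNull x
  norm_le (n : ℕ) : ‖x n‖ ≤ 1
  tendsto_norm : Tendsto (fun n => ‖x n‖) atTop (𝓝 1)
  eventually_lt (u : E) (hu : ‖u‖ ≤ 1) (ε : ℝ) (hε : 0 < ε) : ∀ᶠ n in atTop, ‖x n + u‖ < 1 + ε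

section

variable {E : Type*} [NormedAddCommGroup E] [NormedSpace ℝ E]

theorem PropertyM.eventually_norm_add_lt (hM : PropertyM E) {x : ℕ → E} (hx : WeakNull x)
    (hb : IsBoundedUnder (· ≤ ·) atTop fun n => ‖x n‖) {u v : E} (huv : ‖u‖ ≤ ‖v‖) {a b : ℝ}
    (hab : a < b) (ha : ∀ᶠ n in atTop, ‖x n + v‖ ≤ a) : ∀ᶠ n in atTop, ‖x n + u‖ < b := by
  have hbdd : ∀ w : E, IsBoundedUnder (· ≤ ·) atTop fun n => ‖x n + w‖ := by
    intro w
    obtain ⟨B, hB⟩ := hb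
    refine ⟨B + ‖w‖, ?_⟩
    rw [eventually_map] at hB ⊢
    filter_upwards [hB] with n hn
    exact (norm_add_le _ _).trans (by gcongr)
  have hcob : ∀ w : E, IsCoboundedUnder (· ≤ ·) atTop fun n => ‖x n + w‖ := fun w =>
    (isBoundedUnder_of ⟨0, fun n => norm_nonneg _⟩ :
      IsBoundedUnder (· ≥ ·) atTop fun n => ‖x n + w‖).isCoboundedUnder_flip
  refine eventually_lt_of_limsup_lt ?_ (hbdd u)
  exact ((hM x hx u v huv).trans (limsup_le_of_le (hcob v) ha)).trans_lt hab

theorem tendsto_norm_inv_smul_sub {x : ℕ → E} (h : Tendsto (fun n => ‖x n‖) atTop (𝓝 1)) :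
    Tendsto (fun n => ‖‖x n‖⁻¹ • x n - x n‖) atTop (𝓝 0) := by
  have h2 : Tendsto (fun n => |‖x n‖⁻¹ - 1| * ‖x n‖) atTop (𝓝 (|(1 : ℝ)⁻¹ - 1| * 1)) :=
    (((h.inv₀ one_ne_zero).sub_const 1).abs).mul h
  simp only [inv_one, sub_self, abs_zero, zero_mul] at h2
  refine h2.congr fun n => ?_
  rw [← Real.norm_eq_abs, ← norm_smul, sub_smul, one_smul]

theorem PropertyM.isAsymptoticC0 (hM : PropertyM E) {x : ℕ → E} (hx : WeakNull x)
    (h1 : Tendsto (fun n => ‖x n‖) atTop (𝓝 1))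
    (h2 : ∀ ε > 0, ∀ᶠ m in atTop, ∀ᶠ n in atTop, ‖x n - x m‖ ≤ 1 + ε) :
    IsAsymptoticC0 fun n => ‖x n‖⁻¹ • x n where
  weakNull f := by
    have := (h1.inv₀ one_ne_zero).mul (hx f)
    simpa using this
  norm_le n := by
    rw [norm_smul, norm_inv, norm_norm]
    exact inv_mul_le_one
  tendsto_norm := by
    have : Tendsto (fun n => ‖x n‖⁻¹ * ‖x n‖) atTop (𝓝 ((1 : ℝ)⁻¹ * 1)) :=
      (h1.inv₀ one_ne_zero).mul h1
    simpa [norm_smul] using this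
  eventually_lt u hu ε hε := by
    obtain ⟨δ, hδ0, hδ1, hδε⟩ : ∃ δ : ℝ, 0 < δ ∧ δ < 1 ∧ 4 * δ ≤ ε :=
      ⟨min (ε / 4) (1 / 2), by positivity, (min_le_right _ _).trans_lt (by norm_num),
        by linarith [min_le_left (ε / 4) (1 / 2)]⟩
    obtain ⟨m, hm1, hm2⟩ :=
      ((h1.eventually_const_lt (show 1 - δ < 1 by linarith)).and (h2 δ hδ0)).exists
    have hu' : ‖(1 - δ) • u‖ ≤ ‖-x m‖ := by
      rw [norm_smul, norm_neg, Real.norm_of_nonneg (by linarith)]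
      nlinarith
    have key := hM.eventually_norm_add_lt hx h1.isBoundedUnder_le hu'
      (show 1 + δ < 1 + 2 * δ by linarith) (by simpa [sub_eq_add_neg] using hm2)
    filter_upwards [key, (tendsto_norm_inv_smul_sub h1).eventually_lt_const hδ0] with n hn1 hn2
    have e : ‖x n‖⁻¹ • x n + u = (‖x n‖⁻¹ • x n - x n) + (x n + (1 - δ) • u) + δ • u := by
      module
    rw [e]
    have h3 : ‖δ • u‖ ≤ δ := by
      rw [norm_smul, Real.norm_of_nonneg hδ0.le]
      nlinarith
    linarith [norm_add₃_le (a := ‖x n‖⁻¹ • x n - x n) (b := x n + (1 - δ) • u) (c := δ • u)]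

namespace IsAsymptoticC0

variable {x : ℕ → E}

theorem eventually_smul_add_lt (hx : IsAsymptoticC0 x) (a : ℝ) (u : E) {b : ℝ}
    (hb : max |a| ‖u‖ < b) : ∀ᶠ n in atTop, ‖a • x n + u‖ < b := by
  have hb0 : 0 < b := (le_max_of_le_left (abs_nonneg a)).trans_lt hb
  obtain ⟨m, hm, hmb⟩ := exists_between hb
  have hm0 : 0 < m := (le_max_of_le_left (abs_nonneg a)).trans_lt hm
  have ha := ((le_max_left _ _).trans_lt hm).le
  have hu : ‖m⁻¹ • u‖ ≤ 1 := by
    rw [norm_smul, norm_inv, Real.norm_of_nonneg hm0.le, inv_mul_le_one₀ hm0]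
    exact ((le_max_right _ _).trans_lt hm).le
  have hε : 0 < b / m - 1 := by
    rw [sub_pos, one_lt_div hm0]
    exact hmb
  filter_upwards [hx.eventually_lt _ hu _ hε,
    hx.eventually_lt (-(m⁻¹ • u)) (by rwa [norm_neg]) _ hε] with n hn1 hn2
  rw [add_sub_cancel] at hn1 hn2
  obtain ⟨ha1, ha2⟩ := abs_le.1 ha
  have e : a • x n + u =
      ((m + a) / 2) • (x n + m⁻¹ • u) + (-((m - a) / 2)) • (x n + -(m⁻¹ • u)) := by
    have : u = m • m⁻¹ • u := by rw [smul_inv_smul₀ hm0.ne']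
    nth_rewrite 1 [this]
    module
  rw [e]
  refine (norm_add_le _ _).trans_lt ?_
  rw [norm_smul, norm_smul, norm_neg, Real.norm_of_nonneg (by linarith : 0 ≤ (m + a) / 2),
    Real.norm_of_nonneg (by linarith : 0 ≤ (m - a) / 2)]
  have hbm : b = (m + a) / 2 * (b / m) + (m - a) / 2 * (b / m) := by
    field_simp
    ring
  rw [hbm]
  rcases lt_or_ge 0 (m + a) with h | h
  · have := mul_lt_mul_of_pos_left hn1 (by linarith : 0 < (m + a) / 2)
    have := mul_le_mul_of_nonneg_left hn2.le (by linarith : 0 ≤ (m - a) / 2)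
    linarith
  · have := mul_le_mul_of_nonneg_left hn1.le (by linarith : 0 ≤ (m + a) / 2)
    have := mul_lt_mul_of_pos_left hn2 (by linarith : 0 < (m - a) / 2)
    linarith

theorem tendsto_norm_smul_add (hx : IsAsymptoticC0 x) (a : ℝ) (u : E) :
    Tendsto (fun n => ‖a • x n + u‖) atTop (𝓝 (max |a| ‖u‖)) := by
  refine tendsto_order.2 ⟨fun b hb => ?_, fun b hb => hx.eventually_smul_add_lt a u hb⟩
  rcases le_total |a| ‖u‖ with h | h
  · rw [max_eq_right h] at hb
    obtain ⟨f, hf, hfu⟩ := exists_dual_vector'' ℝ u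
    have h1 : Tendsto (fun n => a * f (x n) + f u) atTop (𝓝 (a * 0 + f u)) :=
      ((hx.weakNull f).const_mul a).add_const _
    rw [mul_zero, zero_add, hfu] at h1
    filter_upwards [h1.eventually_const_lt hb] with n hn
    have h2 := f.le_of_opNorm_le hf (a • x n + u)
    simp only [map_add, map_smul, smul_eq_mul, hfu, one_mul, Real.norm_eq_abs,
      RCLike.ofReal_real_eq_id, id_eq] at h2 hn
    exact hn.trans_le ((le_abs_self _).trans h2)
  · rw [max_eq_left h] at hb
    have h1 := hx.tendsto_norm.const_mul (2 * |a|)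
    have h2 := h1.eventually_const_lt (show |a| + (|a| + b) / 2 < 2 * |a| * 1 by linarith)
    filter_upwards [h2, hx.eventually_smul_add_lt a (-u) (b := |a| + (|a| - b) / 2)
      (by rw [norm_neg, max_eq_left h]; linarith)] with n hn1 hn2
    have e : (2 * a) • x n = (a • x n + u) + (a • x n + -u) := by module
    have h3 := norm_add_le (a • x n + u) (a • x n + -u)
    rw [← e, norm_smul, norm_mul, Real.norm_two, Real.norm_eq_abs] at h3
    linarith

theorem eventually_forall_abs_sub_le (hx : IsAsymptoticC0 x) {K : Set E} (hK : IsCompact K) {ε : ℝ}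
    (hε : 0 < ε) :
    ∀ᶠ n in atTop, ∀ u ∈ K, ∀ a ∈ Set.Icc (-1 : ℝ) 1, |‖a • x n + u‖ - max |a| ‖u‖| ≤ ε := by
  obtain ⟨s, -, hsf, hs⟩ := ((isCompact_Icc (a := (-1 : ℝ)) (b := 1)).prod hK).finite_cover_balls
    (show 0 < ε / 4 by linarith)
  have h : ∀ᶠ n in atTop, ∀ p ∈ s, |‖p.1 • x n + p.2‖ - max |p.1| ‖p.2‖| < ε / 4 := by
    refine (hsf.eventually_all).2 fun p _ => ?_
    have := (hx.tendsto_norm_smul_add p.1 p.2).eventually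
      (Metric.ball_mem_nhds _ (show 0 < ε / 4 by linarith))
    simpa [Real.dist_eq] using this
  filter_upwards [h] with n hn u hu a ha
  obtain ⟨p, hp, hpd⟩ := Set.mem_iUnion₂.1 (hs (Set.mk_mem_prod ha hu))
  rw [Metric.mem_ball, Prod.dist_eq, max_lt_iff, Real.dist_eq, dist_eq_norm] at hpd
  obtain ⟨h1, h2⟩ := hpd
  have h3 := hn p hp
  have h4 : |‖a • x n + u‖ - ‖p.1 • x n + p.2‖| ≤ ε / 2 := by
    refine (abs_norm_sub_norm_le _ _).trans ?_
    have e : a • x n + u - (p.1 • x n + p.2) = (a - p.1) • x n + (u - p.2) := by module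
    rw [e]
    refine (norm_add_le _ _).trans ?_
    rw [norm_smul, Real.norm_eq_abs]
    nlinarith [hx.norm_le n, norm_nonneg (x n), abs_nonneg (a - p.1)]
  have h5 : |max |p.1| ‖p.2‖ - max |a| ‖u‖| ≤ ε / 4 := by
    refine (abs_max_sub_max_le_max _ _ _ _).trans (max_le ?_ ?_)
    · rw [abs_sub_comm] at h1
      exact (abs_abs_sub_abs_le _ _).trans h1.le
    · rw [norm_sub_rev] at h2
      exact (abs_norm_sub_norm_le _ _).trans h2.le
  rw [abs_le] at h4 h5 ⊢
  rw [abs_lt] at h3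
  constructor <;> linarith

/-- A subsequence whose combinations with coefficients in `[-1, 1]` have nearly the norm they would
have in `c₀`. -/
theorem exists_subseq (hx : IsAsymptoticC0 x) {ε : ℕ → ℝ} (hε : ∀ k, 0 < ε k) :
    ∃ φ : ℕ → ℕ, (∀ k, k ≤ φ k) ∧ ∀ t : ℕ → ℝ, (∀ i, |t i| ≤ 1) → ∀ k,
      |‖∑ i ∈ Finset.range (k + 1), t i • x (φ i)‖ -
        max |t k| ‖∑ i ∈ Finset.range k, t i • x (φ i)‖| ≤ ε k := by
  have hstep : ∀ (k : ℕ) (K : {K : Set E // IsCompact K}), ∃ n, k ≤ n ∧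
      ∀ u ∈ K.1, ∀ a ∈ Set.Icc (-1 : ℝ) 1, |‖a • x n + u‖ - max |a| ‖u‖| ≤ ε k := fun k K =>
    ((eventually_ge_atTop k).and (hx.eventually_forall_abs_sub_le K.2 (hε k))).exists
  choose N hN1 hN2 using hstep
  let K : ℕ → {K : Set E // IsCompact K} := fun k =>
    Nat.rec ⟨{0}, isCompact_singleton⟩ (fun k K =>
      ⟨(fun p : ℝ × E => p.1 • x (N k K) + p.2) '' (Set.Icc (-1 : ℝ) 1 ×ˢ K.1),
        (isCompact_Icc.prod K.2).image (by fun_prop)⟩) k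
  have hmem : ∀ t : ℕ → ℝ, (∀ i, |t i| ≤ 1) → ∀ k,
      ∑ i ∈ Finset.range k, t i • x (N i (K i)) ∈ (K k).1 := by
    intro t ht k
    induction k with
    | zero => exact Set.mem_singleton_iff.2 (by simp)
    | succ k ih =>
      rw [Finset.sum_range_succ]
      exact ⟨(t k, _), ⟨abs_le.1 (ht k), ih⟩, add_comm _ _⟩
  refine ⟨fun k => N k (K k), fun k => hN1 k _, fun t ht k => ?_⟩
  rw [Finset.sum_range_succ, add_comm]
  exact hN2 k (K k) _ (hmem t ht k) _ (abs_le.1 (ht k))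

end IsAsymptoticC0

theorem norm_sum_le_of_abs_sub_max_le {z : ℕ → E}
    (hz : ∀ t : ℕ → ℝ, (∀ i, |t i| ≤ 1) → ∀ k, |‖∑ i ∈ Finset.range (k + 1), t i • z i‖ -
        max |t k| ‖∑ i ∈ Finset.range k, t i • z i‖| ≤ (1 / 2) ^ (k + 2))
    {t : ℕ → ℝ} {s : Finset ℕ} {c : ℝ} (hc : 0 ≤ c) (ht : ∀ i ∈ s, |t i| ≤ c) :
    ‖∑ i ∈ s, t i • z i‖ ≤ 3 / 2 * c := by
  rcases hc.eq_or_lt with rfl | hc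
  · rw [Finset.sum_eq_zero fun i hi => by
      rw [abs_nonpos_iff.1 (ht i hi), zero_smul]]
    simp
  let t' : ℕ → ℝ := fun i => if i ∈ s then t i / c else 0
  have ht' : ∀ i, |t' i| ≤ 1 := by
    intro i
    by_cases hi : i ∈ s
    · simp only [t', hi, if_true, abs_div, abs_of_pos hc]
      exact (div_le_one hc).2 (ht i hi)
    · simp [t', hi]
  have hN : ∀ k, ‖∑ i ∈ Finset.range k, t' i • z i‖ ≤ 3 / 2 - (1 / 2) ^ (k + 1) := by
    intro k
    induction k with
    | zero => norm_num
    | succ k ih =>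
      have h1 := (abs_le.1 (hz t' ht' k)).2
      have h2 : max |t' k| ‖∑ i ∈ Finset.range k, t' i • z i‖ ≤ 3 / 2 - (1 / 2) ^ (k + 1) := by
        refine max_le ((ht' k).trans ?_) ih
        have : (1 / 2 : ℝ) ^ k ≤ 1 := pow_le_one₀ (by norm_num) (by norm_num)
        rw [pow_succ]
        linarith
      rw [pow_succ] at h2
      rw [pow_succ, pow_succ] at h1 ⊢
      linarith
  obtain ⟨k, hk⟩ := s.exists_nat_subset_range
  have e : ∑ i ∈ s, t i • z i = c • ∑ i ∈ Finset.range k, t' i • z i := by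
    rw [Finset.smul_sum, ← Finset.sum_subset hk (fun i _ hi => by simp [t', hi])]
    refine Finset.sum_congr rfl fun i hi => ?_
    simp only [t', hi, if_true]
    rw [smul_smul, mul_div_cancel₀ _ hc.ne']
  rw [e, norm_smul, Real.norm_of_nonneg hc.le, mul_comm]
  have h3 : (0 : ℝ) ≤ (1 / 2) ^ (k + 1) := by positivity
  exact mul_le_mul_of_nonneg_right ((hN k).trans (by linarith)) hc.le

theorem le_norm_sum_range_of_abs_sub_max_le {z : ℕ → E}
    (hz : ∀ t : ℕ → ℝ, (∀ i, |t i| ≤ 1) → ∀ k, |‖∑ i ∈ Finset.range (k + 1), t i • z i‖ -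
        max |t k| ‖∑ i ∈ Finset.range k, t i • z i‖| ≤ (1 / 2) ^ (k + 2))
    {t : ℕ → ℝ} {c : ℝ} (hc : 0 < c) (ht : ∀ i, |t i| ≤ c) {j k : ℕ} (hjk : j < k) :
    |t j| - c / 2 ≤ ‖∑ i ∈ Finset.range k, t i • z i‖ := by
  let t' : ℕ → ℝ := fun i => t i / c
  have ht' : ∀ i, |t' i| ≤ 1 := fun i => by
    simp only [t', abs_div, abs_of_pos hc]
    exact (div_le_one hc).2 (ht i)
  have hN : ∀ k, ∀ j < k,
      |t' j| - (1 / 2 - (1 / 2) ^ (k + 1)) ≤ ‖∑ i ∈ Finset.range k, t' i • z i‖ := by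
    intro k
    induction k with
    | zero => simp
    | succ k ih =>
      intro j hj
      have h1 := (abs_le.1 (hz t' ht' k)).1
      have h0 : (1 / 2 : ℝ) ^ k ≤ 1 := pow_le_one₀ (by norm_num) (by norm_num)
      rw [pow_succ, pow_succ] at h1 ⊢
      rcases Nat.lt_succ_iff_lt_or_eq.1 hj with hj | rfl
      · have h2 := ih j hj
        rw [pow_succ] at h2
        linarith [le_max_right |t' k| ‖∑ i ∈ Finset.range k, t' i • z i‖]
      · linarith [le_max_left |t' j| ‖∑ i ∈ Finset.range j, t' i • z i‖]
  have e : ∑ i ∈ Finset.range k, t i • z i = c • ∑ i ∈ Finset.range k, t' i • z i := by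
    rw [Finset.smul_sum]
    refine Finset.sum_congr rfl fun i hi => ?_
    rw [smul_smul, mul_div_cancel₀ _ hc.ne']
  have h3 : (0 : ℝ) ≤ (1 / 2) ^ (k + 1) := by positivity
  have h4 : |t j| = c * |t' j| := by
    simp only [t', abs_div, abs_of_pos hc]
    rw [mul_div_cancel₀ _ hc.ne']
  rw [e, norm_smul, Real.norm_of_nonneg hc.le, h4]
  nlinarith [hN k j hjk]

theorem norm_coe_le_norm_zeroAtInfty (t : C₀(ℕ, ℝ)) (i : ℕ) : |t i| ≤ ‖t‖ := by
  rw [← Real.norm_eq_abs, ← ZeroAtInftyContinuousMap.norm_toBCF_eq_norm]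
  exact t.toBCF.norm_coe_le_norm i

theorem zeroAtInfty_norm_le {t : C₀(ℕ, ℝ)} {c : ℝ} (hc : 0 ≤ c) (h : ∀ i, |t i| ≤ c) :
    ‖t‖ ≤ c := by
  rw [← ZeroAtInftyContinuousMap.norm_toBCF_eq_norm]
  exact (BoundedContinuousFunction.norm_le hc).2 h

theorem tendsto_zeroAtInfty_nat (t : C₀(ℕ, ℝ)) : Tendsto t atTop (𝓝 0) := by
  have := zero_at_infty t
  rwa [cocompact_eq_cofinite, Nat.cofinite_eq_atTop] at this

theorem IsAsymptoticC0.embedsIso [CompleteSpace E] {x : ℕ → E} (hx : IsAsymptoticC0 x) :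
    EmbedsIso C₀(ℕ, ℝ) E := by
  obtain ⟨φ, -, hz⟩ := hx.exists_subseq (ε := fun k => (1 / 2) ^ (k + 2)) fun k => by positivity
  set z : ℕ → E := fun i => x (φ i)
  have hsum : ∀ t : C₀(ℕ, ℝ), Summable fun i => t i • z i := by
    intro t
    rw [summable_iff_vanishing_norm]
    intro ε hε
    obtain ⟨n, hn⟩ := eventually_atTop.1
      ((tendsto_zeroAtInfty_nat t).eventually (Metric.ball_mem_nhds _ (half_pos hε)))
    refine ⟨Finset.range n, fun s hs => ?_⟩
    refine (norm_sum_le_of_abs_sub_max_le hz (half_pos hε).le fun i hi => ?_).trans_lt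
      (by linarith)
    have hi' : n ≤ i := by
      by_contra! h
      exact Finset.disjoint_left.1 hs hi (Finset.mem_range.2 h)
    simpa using (hn i hi').le
  let T : C₀(ℕ, ℝ) →ₗ[ℝ] E :=
    { toFun := fun t => ∑' i, t i • z i
      map_add' := fun s t => by
        rw [← (hsum s).tsum_add (hsum t)]
        simp [add_smul]
      map_smul' := fun c t => by
        rw [RingHom.id_apply, ← (hsum t).tsum_const_smul c]
        simp [smul_smul] }
  have hT : ∀ t, Tendsto (fun k => ‖∑ i ∈ Finset.range k, t i • z i‖) atTop (𝓝 ‖T t‖) :=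
    fun t => (hsum t).hasSum.tendsto_sum_nat.norm
  have hle : ∀ t, ‖T t‖ ≤ 3 / 2 * ‖t‖ := fun t =>
    le_of_tendsto' (hT t) fun k => norm_sum_le_of_abs_sub_max_le hz (norm_nonneg t)
      fun i _ => norm_coe_le_norm_zeroAtInfty t i
  have hge : ∀ t, 1 / 2 * ‖t‖ ≤ ‖T t‖ := by
    intro t
    rcases (norm_nonneg t).eq_or_lt with h | h
    · rw [← h]
      simp
    · have := zeroAtInfty_norm_le (t := t) (c := ‖T t‖ + ‖t‖ / 2) (by positivity) fun j => by
        have : |t j| - ‖t‖ / 2 ≤ ‖T t‖ := by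
          refine ge_of_tendsto (hT t) ?_
          filter_upwards [eventually_gt_atTop j] with k hk
          exact le_norm_sum_range_of_abs_sub_max_le hz h (norm_coe_le_norm_zeroAtInfty t) hk
        linarith
      linarith
  refine ⟨T.mkContinuous _ hle, ?_, 1 / 2, by norm_num, hge⟩
  rw [injective_iff_map_eq_zero]
  intro t ht
  have h1 := hge t
  have h2 : T t = 0 := ht
  rw [h2, norm_zero] at h1
  exact norm_le_zero_iff.1 (by linarith)

end

section

variable {E : Type*} [NormedAddCommGroup E] [NormedSpace ℝ E]

theorem tendsto_norm_sub_of_sum_bound {x y : ℕ → E} {d : ℝ}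
    (hxy : ∀ n k, ‖x n - y k‖ ≤ d)
    (hx : ∀ n : ℕ, d - d / (n + 1) ^ 2 ≤
      ‖∑ i ∈ Finset.range (n + 1), ((n : ℝ) + 1)⁻¹ • y i - x n‖) (k : ℕ) :
    Tendsto (fun n => ‖x n - y k‖) atTop (𝓝 d) := by
  have h0 : Tendsto (fun n : ℕ => d - d * (1 / ((n : ℝ) + 1))) atTop (𝓝 (d - d * 0)) :=
    (tendsto_one_div_add_atTop_nhds_zero_nat.const_mul d).const_sub d
  rw [mul_zero, sub_zero] at h0
  refine tendsto_of_tendsto_of_tendsto_of_le_of_le' h0 tendsto_const_nhds ?_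
    (.of_forall fun n => hxy n k)
  filter_upwards [eventually_ge_atTop k] with n hn
  have hn1 : (0 : ℝ) < n + 1 := by positivity
  have e : ∑ i ∈ Finset.range (n + 1), ((n : ℝ) + 1)⁻¹ • y i - x n =
      ((n : ℝ) + 1)⁻¹ • ∑ i ∈ Finset.range (n + 1), (y i - x n) := by
    rw [Finset.sum_sub_distrib, Finset.sum_const, Finset.card_range, smul_sub, Finset.smul_sum,
      ← Nat.cast_smul_eq_nsmul ℝ, smul_smul]
    push_cast
    rw [inv_mul_cancel₀ hn1.ne', one_smul]
  have hk : k ∈ Finset.range (n + 1) := Finset.mem_range.2 (by omega)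
  have h1 : ‖∑ i ∈ Finset.range (n + 1), (y i - x n)‖ ≤ ‖x n - y k‖ + n * d := by
    refine (norm_sum_le _ _).trans ?_
    rw [← Finset.add_sum_erase _ _ hk, norm_sub_rev (y k)]
    gcongr
    refine (Finset.sum_le_card_nsmul _ _ d fun i _ => ?_).trans ?_
    · rw [norm_sub_rev]
      exact hxy n i
    · rw [Finset.card_erase_of_mem hk, Finset.card_range, nsmul_eq_mul]
      simp
  have h2 := hx n
  rw [e, norm_smul, norm_inv, Real.norm_of_nonneg hn1.le] at h2
  have h3 := h2.trans (mul_le_mul_of_nonneg_left h1 (by positivity))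
  rw [inv_mul_eq_div, le_div_iff₀ hn1] at h3
  have h4 : (d - d / ((n : ℝ) + 1) ^ 2) * (n + 1) = d * (n + 1) - d * (1 / (n + 1)) := by
    field_simp
  linarith

theorem isBounded_of_isCompact_toWeakSpace {C : Set E} (hC : IsCompact (toWeakSpace ℝ E '' C)) :
    Bornology.IsBounded C := by
  obtain ⟨B, hB⟩ := banach_steinhaus
    (g := fun p : C => NormedSpace.inclusionInDoubleDual ℝ E p) fun f => by
      have hf : Continuous fun p : WeakSpace ℝ E => topDualPairing ℝ E f p :=
        WeakBilin.eval_continuous (topDualPairing ℝ E).flip f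
      obtain ⟨B, hB⟩ := (hC.image hf).isBounded.exists_norm_le
      exact ⟨B, fun p => hB _ ⟨_, ⟨p, p.2, rfl⟩, rfl⟩⟩
  refine (isBounded_iff_forall_norm_le).2 ⟨B, fun p hp => ?_⟩
  rw [← (NormedSpace.inclusionInDoubleDualLi ℝ (E := E)).norm_map p]
  exact hB ⟨p, hp⟩

theorem exists_weak_tendsto_subseq [TopologicalSpace.SeparableSpace E] {C : Set E}
    (hC : IsCompact (toWeakSpace ℝ E '' C)) {x : ℕ → E} (hx : ∀ n, x n ∈ C) :
    ∃ p ∈ C, ∃ φ : ℕ → ℕ, StrictMono φ ∧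
      ∀ f : E →L[ℝ] ℝ, Tendsto (fun n => f (x (φ n))) atTop (𝓝 (f p)) := by
  have heval : ∀ f : E →L[ℝ] ℝ, Continuous fun p : WeakSpace ℝ E => topDualPairing ℝ E f p :=
    fun f => WeakBilin.eval_continuous (topDualPairing ℝ E).flip f
  obtain ⟨e, he⟩ := TopologicalSpace.exists_dense_seq E
  choose f hf hfe using fun n => exists_dual_vector'' ℝ (e n)
  have hsep : ∀ p, (∀ n, f n p = 0) → p = 0 := by
    intro p hp
    by_contra h
    have hp0 : 0 < ‖p‖ := norm_pos_iff.2 h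
    obtain ⟨n, hn⟩ := he.exists_dist_lt p (half_pos hp0)
    have h1 := (f n).le_of_opNorm_le (hf n) (e n - p)
    rw [map_sub, hp, sub_zero, hfe, one_mul] at h1
    rw [dist_eq_norm, norm_sub_rev] at hn
    have h2 : ‖e n‖ ≤ ‖e n - p‖ := by simpa using h1
    have h3 := norm_sub_norm_le p (p - e n)
    rw [sub_sub_cancel, norm_sub_rev p] at h3
    linarith
  let S := toWeakSpace ℝ E '' C
  have : CompactSpace S := isCompact_iff_compactSpace.1 hC
  let Φ : S → ℕ → ℝ := fun p n => topDualPairing ℝ E (f n) p.1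
  have hΦ : Continuous Φ := continuous_pi fun n => (heval (f n)).comp continuous_subtype_val
  have hinj : Function.Injective Φ := by
    intro p q hpq
    refine Subtype.ext (sub_eq_zero.1 (hsep (p.1 - q.1 : E) fun n => ?_))
    have := congrFun hpq n
    exact (map_sub (f n) _ _).trans (sub_eq_zero.2 this)
  have : FirstCountableTopology S :=
    (hΦ.isClosedEmbedding hinj).isInducing.firstCountableTopology
  obtain ⟨⟨-, p, hp, rfl⟩, φ, hφ, h⟩ :=
    CompactSpace.tendsto_subseq (X := S) fun n => ⟨toWeakSpace ℝ E (x n), x n, hx n, rfl⟩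
  refine ⟨p, hp, φ, hφ, fun g => ?_⟩
  exact (((heval g).comp continuous_subtype_val).tendsto _).comp h

theorem exists_isAsymptoticC0_of_not_weakNormalStructure [TopologicalSpace.SeparableSpace E]
    (hM : PropertyM E) (h : ¬ WeakNormalStructure E) :
    ∃ x : ℕ → E, IsAsymptoticC0 x := by
  unfold WeakNormalStructure at h
  push Not at h
  obtain ⟨C, hconv, hcomp, hnt, hdiam⟩ := h
  have hbdd := isBounded_of_isCompact_toWeakSpace hcomp
  set d := Metric.diam C
  have hd : 0 < d := Metric.diam_pos hnt hbdd
  have hle : ∀ p ∈ C, ∀ q ∈ C, ‖p - q‖ ≤ d := fun p hp q hq => by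
    rw [← dist_eq_norm]
    exact Metric.dist_le_diam_of_mem hbdd hp hq
  have : Nonempty C := hnt.nonempty.to_subtype
  obtain ⟨y, hy⟩ := TopologicalSpace.exists_dense_seq C
  have hex : ∀ n : ℕ, ∃ x ∈ C, d - d / (n + 1) ^ 2 ≤
      ‖∑ i ∈ Finset.range (n + 1), ((n : ℝ) + 1)⁻¹ • (y i : E) - x‖ := by
    intro n
    have hmem : ∑ i ∈ Finset.range (n + 1), ((n : ℝ) + 1)⁻¹ • (y i : E) ∈ C := by
      refine hconv.sum_mem (fun i _ => by positivity) ?_ fun i _ => (y i).2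
      rw [Finset.sum_const, Finset.card_range, nsmul_eq_mul]
      push_cast
      exact mul_inv_cancel₀ (by positivity)
    obtain ⟨-, ⟨x, hx, rfl⟩, hlt⟩ := exists_lt_of_lt_csSup (hnt.nonempty.image _)
      ((sub_lt_self d (by positivity : 0 < d / ((n : ℝ) + 1) ^ 2)).trans_le (hdiam _ hmem))
    exact ⟨x, hx, hlt.le⟩
  choose x hxC hx using hex
  have hlimy := tendsto_norm_sub_of_sum_bound (fun n k => hle _ (hxC n) _ (y k).2) hx
  have hlim : ∀ p ∈ C, Tendsto (fun n => ‖x n - p‖) atTop (𝓝 d) := by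
    intro p hp
    refine tendsto_order.2 ⟨fun b hb => ?_, fun b hb =>
      .of_forall fun n => (hle _ (hxC n) p hp).trans_lt hb⟩
    obtain ⟨k, hk⟩ := hy.exists_dist_lt ⟨p, hp⟩ (half_pos (sub_pos.2 hb))
    rw [Subtype.dist_eq, dist_eq_norm] at hk
    filter_upwards [(hlimy k).eventually_const_lt (show (b + d) / 2 < d by linarith)] with n hn
    have := norm_sub_le_norm_sub_add_norm_sub (x n) p (y k)
    simp only at hk
    linarith
  obtain ⟨p, hp, φ, hφ, hw⟩ := exists_weak_tendsto_subseq hcomp hxC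
  refine ⟨_, hM.isAsymptoticC0 (x := fun n => d⁻¹ • (x (φ n) - p)) (fun f => ?_) ?_
    fun ε hε => .of_forall fun m => .of_forall fun n => ?_⟩
  · simpa using ((hw f).sub_const (f p)).const_mul d⁻¹
  · have := ((hlim p hp).comp hφ.tendsto_atTop).const_mul d⁻¹
    rw [inv_mul_cancel₀ hd.ne'] at this
    refine this.congr fun n => ?_
    rw [norm_smul, norm_inv, Real.norm_of_nonneg hd.le]
    rfl
  · rw [← smul_sub, sub_sub_sub_cancel_right, norm_smul, norm_inv, Real.norm_of_nonneg hd.le,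
      inv_mul_eq_div]
    exact ((div_le_one hd).2 (hle _ (hxC _) _ (hxC _))).trans (by linarith)

end

section

variable {E : Type*} [NormedAddCommGroup E] [NormedSpace ℝ E]

theorem exists_convex_isCompact_toWeakSpace [CompleteSpace E] {y : ℕ → E} (hy : WeakNull y)
    (hy1 : ∀ n, ‖y n‖ ≤ 1) :
    ∃ C : Set E, Convex ℝ C ∧ IsCompact (toWeakSpace ℝ E '' C) ∧ 0 ∈ C ∧ (∀ n, y n ∈ C) ∧
      C ⊆ closure (convexHull ℝ (insert 0 (Set.range y))) := by
  let K : Set (ℕ → ℝ) := {t | (∀ i, 0 ≤ t i) ∧ ∀ s : Finset ℕ, ∑ i ∈ s, t i ≤ 1}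
  have hKsum : ∀ t ∈ K, Summable t := fun t ht => summable_of_sum_le ht.1 ht.2
  have hsum : ∀ t ∈ K, Summable fun i => t i • y i := fun t ht => by
    refine Summable.of_norm_bounded (hKsum t ht) fun i => ?_
    rw [norm_smul, Real.norm_of_nonneg (ht.1 i)]
    exact mul_le_of_le_one_right (ht.1 i) (hy1 i)
  have hKcomp : IsCompact K := by
    refine (isCompact_univ_pi fun _ : ℕ => isCompact_Icc (a := (0 : ℝ)) (b := 1)).of_isClosed_subset
      ?_ fun t ht i _ => ⟨ht.1 i, by simpa using ht.2 {i}⟩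
    have hKeq : K = (⋂ i, {t | 0 ≤ t i}) ∩ ⋂ s : Finset ℕ, {t | ∑ i ∈ s, t i ≤ 1} := by
      ext t
      simp [K]
    rw [hKeq]
    exact (isClosed_iInter fun i => isClosed_le continuous_const (continuous_apply i)).inter
      (isClosed_iInter fun s => isClosed_le (by fun_prop) continuous_const)
  have hKconv : Convex ℝ K := by
    intro s hs t ht a b ha hb hab
    refine ⟨fun i => ?_, fun F => ?_⟩
    · have := mul_nonneg ha (hs.1 i)
      have := mul_nonneg hb (ht.1 i)
      simp only [Pi.add_apply, Pi.smul_apply, smul_eq_mul]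
      linarith
    · simp only [Pi.add_apply, Pi.smul_apply, smul_eq_mul, Finset.sum_add_distrib,
        ← Finset.mul_sum]
      have := mul_le_mul_of_nonneg_left (hs.2 F) ha
      have := mul_le_mul_of_nonneg_left (ht.2 F) hb
      linarith
  let S : (ℕ → ℝ) → E := fun t => ∑' i, t i • y i
  have hcont : ∀ f : E →L[ℝ] ℝ, ContinuousOn (fun t => f (S t)) K := by
    intro f
    have hu : TendstoUniformlyOn (fun (n : ℕ) t => ∑ i ∈ Finset.range n, t i * f (y i))
        (fun t => f (S t)) atTop K := by
      rw [Metric.tendstoUniformlyOn_iff]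
      intro ε hε
      obtain ⟨n, hn⟩ := eventually_atTop.1
        ((hy f).eventually (Metric.ball_mem_nhds _ (half_pos hε)))
      filter_upwards [eventually_ge_atTop n] with k hk t ht
      have h1 : Tendsto (fun m => ∑ i ∈ Finset.range m, t i * f (y i)) atTop (𝓝 (f (S t))) := by
        have := ((hsum t ht).hasSum.tendsto_sum_nat)
        have := (f.continuous.tendsto _).comp this
        refine this.congr fun m => ?_
        simp
      have h2 : dist (f (S t)) (∑ i ∈ Finset.range k, t i * f (y i)) ≤ ε / 2 := by
        refine le_of_tendsto (h1.dist tendsto_const_nhds) ?_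
        filter_upwards [eventually_ge_atTop k] with m hm
        rw [Real.dist_eq, ← Finset.sum_Ico_eq_sub _ hm]
        refine (Finset.abs_sum_le_sum_abs _ _).trans ?_
        calc ∑ i ∈ Finset.Ico k m, |t i * f (y i)| ≤ ∑ i ∈ Finset.Ico k m, t i * (ε / 2) := by
              refine Finset.sum_le_sum fun i hi => ?_
              have h3 := hn i (hk.trans (Finset.mem_Ico.1 hi).1)
              rw [Real.dist_0_eq_abs] at h3
              rw [abs_mul, abs_of_nonneg (ht.1 i)]
              exact mul_le_mul_of_nonneg_left h3.le (ht.1 i)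
          _ ≤ ε / 2 := by
              rw [← Finset.sum_mul]
              exact mul_le_of_le_one_left (half_pos hε).le (ht.2 _)
      linarith
    exact hu.continuousOn (.of_forall fun n => by fun_prop)
  have hSsub : ∀ t ∈ K, S t ∈ closure (convexHull ℝ (insert 0 (Set.range y))) := by
    intro t ht
    refine mem_closure_of_tendsto (hsum t ht).hasSum.tendsto_sum_nat (.of_forall fun n => ?_)
    have h0 : (0 : E) ∈ convexHull ℝ (insert 0 (Set.range y)) :=
      subset_convexHull ℝ _ (Set.mem_insert _ _)
    have hy' : ∀ i, y i ∈ convexHull ℝ (insert 0 (Set.range y)) := fun i =>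
      subset_convexHull ℝ _ (Set.mem_insert_of_mem _ ⟨i, rfl⟩)
    have h1 := (convex_convexHull ℝ (insert 0 (Set.range y))).sum_mem
      (t := Finset.insertNone (Finset.range n))
      (w := fun o => o.elim (1 - ∑ i ∈ Finset.range n, t i) t) (z := fun o => o.elim 0 y)
      (by
        rintro (_ | i) -
        · exact sub_nonneg.2 (ht.2 _)
        · exact ht.1 i)
      (by simp [Finset.sum_insertNone])
      (by
        rintro (_ | i) -
        · exact h0
        · exact hy' i)
    simpa [Finset.sum_insertNone] using h1
  refine ⟨S '' K, ?_, ?_, ⟨0, ⟨fun _ => le_rfl, fun s => by simp⟩, by simp [S]⟩, fun n =>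
    ⟨Pi.single n 1, ⟨fun i => ?_, fun s => ?_⟩, ?_⟩, ?_⟩
  · rintro - ⟨s, hs, rfl⟩ - ⟨t, ht, rfl⟩ a b ha hb hab
    refine ⟨a • s + b • t, hKconv hs ht ha hb hab, ?_⟩
    simp only [S]
    rw [← (hsum s hs).tsum_const_smul, ← (hsum t ht).tsum_const_smul,
      ← ((hsum s hs).const_smul a).tsum_add ((hsum t ht).const_smul b)]
    simp [add_smul, mul_smul]
  · rw [Set.image_image]
    refine hKcomp.image_of_continuousOn ?_
    rw [continuousOn_iff_continuous_domRestrict]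
    exact WeakBilin.continuous_of_continuous_eval _ fun f =>
      continuousOn_iff_continuous_domRestrict.1 (hcont f)
  · by_cases h : i = n
    · subst h
      simp
    · simp [h]
  · simp only [Pi.single_apply, Finset.sum_ite_eq']
    split_ifs <;> norm_num
  · simp only [S]
    rw [tsum_eq_single n fun i hi => by simp [hi]]
    simp
  · rintro - ⟨t, ht, rfl⟩
    exact hSsub t ht

theorem IsAsymptoticC0.not_weakNormalStructure [CompleteSpace E] (hM : PropertyM E) {x : ℕ → E}
    (hx : IsAsymptoticC0 x) : ¬ WeakNormalStructure E := by
  intro hwns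
  obtain ⟨φ, hφ, hz⟩ := hx.exists_subseq (ε := fun k => (1 / 2) ^ (k + 2)) fun k => by positivity
  have hφ' : Tendsto φ atTop atTop := tendsto_atTop_mono hφ tendsto_id
  set z : ℕ → E := fun i => x (φ i)
  set δ : ℕ → ℝ := fun k => (1 / 2) ^ (k + 2)
  have hδ0 : ∀ k, 0 < δ k := fun k => by positivity
  have hδ1 : ∀ k, δ k < 1 := fun k => pow_lt_one₀ (by norm_num) (by norm_num) (by omega)
  have hδmono : ∀ m k, m < k → δ k ≤ δ m := fun m k hmk =>
    pow_le_pow_of_le_one (by norm_num) (by norm_num) (by omega)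
  have hδ : Tendsto (fun k => 1 - δ k) atTop (𝓝 1) := by
    have := ((tendsto_pow_atTop_nhds_zero_of_lt_one (r := (1 / 2 : ℝ)) (by norm_num)
      (by norm_num)).comp (tendsto_add_atTop_nat 2)).const_sub 1
    rwa [sub_zero] at this
  have hz1 : ∀ k, ‖z k‖ ≤ 1 := fun k => hx.norm_le _
  have hzz : ∀ m k, m < k → ‖z k - z m‖ ≤ 1 + δ k := by
    intro m k hmk
    have h1 := hz (Pi.single k 1 - Pi.single m 1) (fun i => by
      by_cases hik : i = k
      · subst hik
        simp [hmk.ne']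
      · by_cases him : i = m
        · subst him
          simp [hik]
        · simp [hik, him]) k
    have h2 : ∑ i ∈ Finset.range k, (Pi.single k 1 - Pi.single m 1 : ℕ → ℝ) i • z i = -z m := by
      simp [sub_smul, Finset.sum_sub_distrib, Pi.single_apply, ite_smul, hmk]
    rw [Finset.sum_range_succ, h2] at h1
    have h3 : (Pi.single k 1 - Pi.single m 1 : ℕ → ℝ) k = 1 := by simp [hmk.ne']
    rw [h3, abs_one, one_smul, norm_neg, max_eq_left (hz1 m), neg_add_eq_sub] at h1
    linarith [(abs_le.1 h1).2]
  let y : ℕ → E := fun k => (1 - δ k) • z k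
  have hynull : WeakNull y := fun f => by
    simpa [y] using hδ.mul ((hx.weakNull f).comp hφ')
  have hynorm : ∀ k, ‖y k‖ = (1 - δ k) * ‖z k‖ := fun k => by
    rw [norm_smul, Real.norm_of_nonneg (by linarith [hδ1 k])]
  have hylim : Tendsto (fun k => ‖y k‖) atTop (𝓝 1) := by
    simp only [hynorm]
    simpa using hδ.mul (hx.tendsto_norm.comp hφ')
  have hy1 : ∀ k, ‖y k‖ ≤ 1 := fun k => by
    rw [hynorm]
    nlinarith [hδ0 k, hδ1 k, hz1 k, norm_nonneg (z k)]
  have hyy' : ∀ m k, m < k → ‖y k - y m‖ ≤ 1 := by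
    intro m k hmk
    have e : y k - y m = (1 - δ m) • (z k - z m) + (δ m - δ k) • z k := by
      simp only [y]
      module
    rw [e]
    refine (norm_add_le _ _).trans ?_
    rw [norm_smul, norm_smul, Real.norm_of_nonneg (by linarith [hδ1 m]),
      Real.norm_of_nonneg (by linarith [hδmono m k hmk])]
    have h1 := mul_le_mul_of_nonneg_left (hzz m k hmk) (by linarith [hδ1 m] : 0 ≤ 1 - δ m)
    have h2 := mul_le_mul_of_nonneg_left (hz1 k) (by linarith [hδmono m k hmk] : 0 ≤ δ m - δ k)
    nlinarith [hδ0 m, hδ0 k, mul_pos (hδ0 m) (hδ0 k)]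
  obtain ⟨C, hconv, hcomp, h0C, hyC, hCsub⟩ := exists_convex_isCompact_toWeakSpace hynull hy1
  have hdist : ∀ p ∈ insert 0 (Set.range y), ∀ q ∈ insert 0 (Set.range y), dist p q ≤ 1 := by
    rintro p (rfl | ⟨k, rfl⟩) q (rfl | ⟨m, rfl⟩)
    · simp
    · simpa using hy1 m
    · simpa using hy1 k
    · rcases lt_trichotomy m k with h | rfl | h
      · rw [dist_eq_norm]
        exact hyy' m k h
      · simp
      · rw [dist_comm, dist_eq_norm]
        exact hyy' k m h
  have hbdd : Bornology.IsBounded (closure (convexHull ℝ (insert 0 (Set.range y)))) :=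
    (isBounded_convexHull.2 (Metric.isBounded_iff.2 ⟨1, fun p hp q hq => hdist p hp q hq⟩)).closure
  have hdiam : Metric.diam C ≤ 1 := by
    refine (Metric.diam_mono hCsub hbdd).trans ?_
    rw [Metric.diam_closure, convexHull_diam]
    exact Metric.diam_le_of_forall_dist_le zero_le_one hdist
  have hnt : C.Nontrivial := by
    obtain ⟨k, hk⟩ := (hylim.eventually_const_lt one_half_lt_one).exists
    refine ⟨0, h0C, y k, hyC k, fun h => ?_⟩
    rw [← h, norm_zero] at hk
    norm_num at hk
  obtain ⟨p, hp, hlt⟩ := hwns C hconv hcomp hnt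
  set r := sSup ((fun q => ‖p - q‖) '' C)
  have hr : ∀ n, ‖y n + -p‖ ≤ r := fun n => by
    rw [← sub_eq_add_neg, norm_sub_rev]
    refine le_csSup ⟨Metric.diam C, ?_⟩ ⟨y n, hyC n, rfl⟩
    rintro - ⟨q, hq, rfl⟩
    change ‖p - q‖ ≤ _
    rw [← dist_eq_norm]
    exact Metric.dist_le_diam_of_mem (hbdd.subset hCsub) hp hq
  have hr1 : r < 1 := hlt.trans_le hdiam
  have h1 := hM.eventually_norm_add_lt hynull hylim.isBoundedUnder_le (u := 0) (v := -p) (by simp)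
    (show r < (r + 1) / 2 by linarith) (.of_forall hr)
  obtain ⟨n, hn1, hn2⟩ :=
    (h1.and (hylim.eventually_const_lt (show (r + 1) / 2 < 1 by linarith))).exists
  rw [add_zero] at hn1
  linarith

/-- The supremum of `‖T y‖` over the unit ball elements vanishing before `n`. -/
noncomputable def tailNorm (T : C₀(ℕ, ℝ) →L[ℝ] E) (n : ℕ) : ℝ :=
  sSup ((fun y => ‖T y‖) '' {y | ‖y‖ ≤ 1 ∧ ∀ i < n, y i = 0})

variable (T : C₀(ℕ, ℝ) →L[ℝ] E)

theorem bddAbove_tailNorm (n : ℕ) :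
    BddAbove ((fun y => ‖T y‖) '' {y : C₀(ℕ, ℝ) | ‖y‖ ≤ 1 ∧ ∀ i < n, y i = 0}) := by
  refine ⟨‖T‖, ?_⟩
  rintro - ⟨y, ⟨hy, -⟩, rfl⟩
  exact T.unit_le_opNorm y hy

theorem tailNorm_nonneg (n : ℕ) : 0 ≤ tailNorm T n :=
  Real.sSup_nonneg (by rintro - ⟨y, -, rfl⟩; exact norm_nonneg _)

theorem norm_le_tailNorm_mul {n : ℕ} {y : C₀(ℕ, ℝ)} (hy : ∀ i < n, y i = 0) {c : ℝ}
    (hc : 0 < c) (hyc : ‖y‖ ≤ c) : ‖T y‖ ≤ tailNorm T n * c := by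
  have h : ‖T (c⁻¹ • y)‖ ≤ tailNorm T n := by
    refine le_csSup (bddAbove_tailNorm T n) ⟨_, ⟨?_, fun i hi => ?_⟩, rfl⟩
    · rw [norm_smul, norm_inv, Real.norm_of_nonneg hc.le]
      exact (inv_mul_le_one₀ hc).2 hyc
    · simp [hy i hi]
  rw [map_smul, norm_smul, norm_inv, Real.norm_of_nonneg hc.le, inv_mul_le_iff₀ hc] at h
  rwa [mul_comm]

theorem tailNorm_antitone : Antitone (tailNorm T) := by
  intro m n hmn
  refine csSup_le_csSup (bddAbove_tailNorm T m) ⟨_, 0, ⟨by simp, fun i _ => rfl⟩, rfl⟩ ?_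
  exact Set.image_mono fun y hy => ⟨hy.1, fun i hi => hy.2 i (hi.trans_le hmn)⟩

/-- Unit ball elements moving off to infinity along which `T` attains its asymptotic norm. -/
theorem exists_seq_tailNorm : ∃ (K : ℝ) (y : ℕ → C₀(ℕ, ℝ)), Tendsto (tailNorm T) atTop (𝓝 K) ∧
    (∀ n, ‖y n‖ ≤ 1) ∧ (∀ n, ∀ i < n, y n i = 0) ∧
    Tendsto (fun n => ‖T (y n)‖) atTop (𝓝 K) := by
  have hK := tendsto_atTop_ciInf (tailNorm_antitone T)
    ⟨0, by rintro - ⟨n, rfl⟩; exact tailNorm_nonneg T n⟩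
  have hex : ∀ n : ℕ, ∃ y : C₀(ℕ, ℝ), (‖y‖ ≤ 1 ∧ ∀ i < n, y i = 0) ∧
      tailNorm T n - 1 / ((n : ℝ) + 1) < ‖T y‖ := by
    intro n
    obtain ⟨-, ⟨y, hy, rfl⟩, hlt⟩ := exists_lt_of_lt_csSup
      (s := (fun y => ‖T y‖) '' {y : C₀(ℕ, ℝ) | ‖y‖ ≤ 1 ∧ ∀ i < n, y i = 0})
      ⟨_, 0, ⟨by simp, fun i _ => rfl⟩, rfl⟩
      (sub_lt_self (tailNorm T n) (by positivity : 0 < 1 / ((n : ℝ) + 1)))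
    exact ⟨y, hy, hlt⟩
  choose y hy hyT using hex
  refine ⟨_, y, hK, fun n => (hy n).1, fun n => (hy n).2, ?_⟩
  refine tendsto_of_tendsto_of_tendsto_of_le_of_le ?_ hK (fun n => (hyT n).le) fun n => ?_
  · simpa using hK.sub tendsto_one_div_add_atTop_nhds_zero_nat
  · exact le_csSup (bddAbove_tailNorm T n) ⟨y n, hy n, rfl⟩

theorem eventually_norm_add_le_tailNorm {y : ℕ → C₀(ℕ, ℝ)} (hy1 : ∀ n, ‖y n‖ ≤ 1)
    (hy : ∀ n, ∀ i < n, y n i = 0) (m : ℕ) {δ : ℝ} (hδ : 0 < δ) {a : ℝ} (ha : |a| = 1) :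
    ∀ᶠ n in atTop, ‖T (y n + a • y m)‖ ≤ tailNorm T m * (1 + δ) := by
  have h := (tendsto_zeroAtInfty_nat (y m)).eventually (Metric.ball_mem_nhds _ hδ)
  obtain ⟨N, hN⟩ := eventually_atTop.1 h
  filter_upwards [eventually_ge_atTop (max N m)] with n hn
  have hnN := (le_max_left _ _).trans hn
  have hnm := (le_max_right _ _).trans hn
  refine norm_le_tailNorm_mul T (fun i hi => ?_) (by linarith)
    (zeroAtInfty_norm_le (by linarith) fun i => ?_)
  · simp [hy n i (by omega), hy m i hi]
  · rw [ZeroAtInftyContinuousMap.add_apply, ZeroAtInftyContinuousMap.smul_apply, smul_eq_mul]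
    refine (abs_add_le _ _).trans ?_
    rw [abs_mul, ha, one_mul]
    rcases lt_or_ge i n with hi | hi
    · rw [hy n i hi, abs_zero]
      linarith [(norm_coe_le_norm_zeroAtInfty (y m) i).trans (hy1 m)]
    · have h1 := hN i (hnN.trans hi)
      rw [Real.dist_0_eq_abs] at h1
      linarith [(norm_coe_le_norm_zeroAtInfty (y n) i).trans (hy1 n)]

theorem tendsto_tailNorm_dual (f : C₀(ℕ, ℝ) →L[ℝ] ℝ) : Tendsto (tailNorm f) atTop (𝓝 0) := by
  obtain ⟨K, y, hK, hy1, hy, hyK⟩ := exists_seq_tailNorm f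
  have hK0 : 0 ≤ K := ge_of_tendsto' hK (tailNorm_nonneg f)
  suffices K = 0 by rwa [this] at hK
  by_contra hne
  have hKpos : 0 < K := lt_of_le_of_ne hK0 (Ne.symm hne)
  obtain ⟨m, hm1, hm2⟩ := ((hK.eventually_lt_const (show K < 5 / 4 * K by linarith)).and
    (hyK.eventually_const_lt (show 9 / 10 * K < K by linarith))).exists
  obtain ⟨n, ⟨hn1, hn2⟩, hn3⟩ := (((eventually_norm_add_le_tailNorm f hy1 hy m
    (show (0 : ℝ) < 1 / 5 by norm_num) (a := 1) (by simp)).and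
    (eventually_norm_add_le_tailNorm f hy1 hy m
    (show (0 : ℝ) < 1 / 5 by norm_num) (a := -1) (by simp))).and
    (hyK.eventually_const_lt (show 9 / 10 * K < K by linarith))).exists
  simp only [map_add, map_smul, Real.norm_eq_abs, smul_eq_mul, one_mul, neg_mul] at *
  rcases abs_cases (f (y n)) with h1 | h1 <;> rcases abs_cases (f (y m)) with h2 | h2 <;>
  linarith [(abs_le.1 hn1).1, (abs_le.1 hn1).2, (abs_le.1 hn2).1, (abs_le.1 hn2).2]

theorem EmbedsIso.exists_isAsymptoticC0 (hM : PropertyM E) (h : EmbedsIso C₀(ℕ, ℝ) E) :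
    ∃ x : ℕ → E, IsAsymptoticC0 x := by
  obtain ⟨T, -, c, hc, hT⟩ := h
  obtain ⟨K, y, hK, hy1, hy, hyK⟩ := exists_seq_tailNorm T
  have hcK : c ≤ K := by
    refine ge_of_tendsto' hK fun n => ?_
    let e : C₀(ℕ, ℝ) := ⟨⟨Pi.single n 1, continuous_of_discreteTopology⟩, by
      rw [cocompact_eq_cofinite, Nat.cofinite_eq_atTop]
      refine tendsto_const_nhds.congr' ?_
      filter_upwards [eventually_gt_atTop n] with i hi
      simp [hi.ne']⟩
    have he : ∀ i, e i = (Pi.single n 1 : ℕ → ℝ) i := fun i => rfl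
    have h1 : ‖e‖ ≤ 1 := zeroAtInfty_norm_le zero_le_one fun i => by
      rw [he, Pi.single_apply]
      split_ifs <;> simp
    have h2 : 1 ≤ ‖e‖ := by
      simpa [he] using norm_coe_le_norm_zeroAtInfty e n
    have h3 := norm_le_tailNorm_mul T (n := n) (y := e)
      (fun i hi => by rw [he]; simp [hi.ne]) one_pos h1
    nlinarith [hT e]
  have hK0 : 0 < K := hc.trans_le hcK
  refine ⟨_, hM.isAsymptoticC0 (x := fun n => K⁻¹ • T (y n)) (fun f => ?_) ?_ fun ε hε => ?_⟩
  · have h1 : Tendsto (fun n => f (T (y n))) atTop (𝓝 0) := by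
      refine squeeze_zero_norm (fun n => ?_) (tendsto_tailNorm_dual (f.comp T))
      simpa using norm_le_tailNorm_mul (f.comp T) (hy n) one_pos (hy1 n)
    simpa using h1.const_mul K⁻¹
  · simp only [norm_smul, norm_inv, Real.norm_of_nonneg hK0.le]
    simpa [hK0.ne'] using hyK.const_mul K⁻¹
  · obtain ⟨δ, hδ0, hδ⟩ : ∃ δ : ℝ, 0 < δ ∧ (1 + δ) * (1 + δ) ≤ 1 + ε :=
      ⟨min (ε / 3) 1, by positivity, by
        have h1 := min_le_left (ε / 3) 1
        have h2 := min_le_right (ε / 3) 1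
        have h3 : 0 < min (ε / 3) 1 := by positivity
        nlinarith⟩
    filter_upwards [hK.eventually_lt_const (show K < K * (1 + δ) by nlinarith)] with m hm
    filter_upwards [eventually_norm_add_le_tailNorm T hy1 hy m hδ0 (a := -1) (by simp)] with n hn
    rw [← smul_sub, ← map_sub, norm_smul, norm_inv, Real.norm_of_nonneg hK0.le,
      inv_mul_le_iff₀ hK0]
    have e : y n - y m = y n + (-1 : ℝ) • y m := by
      ext i
      simp [sub_eq_add_neg]
    rw [← e] at hn
    calc ‖T (y n - y m)‖ ≤ tailNorm T m * (1 + δ) := hn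
      _ ≤ K * (1 + δ) * (1 + δ) := by gcongr
      _ ≤ K * (1 + ε) := by
        rw [mul_assoc]
        gcongr

end

theorem stmt0 (X : Type*) [NormedAddCommGroup X] [NormedSpace ℝ X] [CompleteSpace X]
    [TopologicalSpace.SeparableSpace X]
    (hM : PropertyM X) :
    ¬ EmbedsIso C₀(ℕ, ℝ) X ↔ WeakNormalStructure X := by
  constructor
  · intro h
    by_contra hw
    obtain ⟨x, hx⟩ := exists_isAsymptoticC0_of_not_weakNormalStructure hM hw
    exact h hx.embedsIso
  · intro hw h
    obtain ⟨x, hx⟩ := h.exists_isAsymptoticC0 hM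
    exact hx.not_weakNormalStructure hM hw
end

section
/- Let X be a separable real Banach space with Property(M). Then c₀ does not embed isomorphically into X if and only if X has Property(K). -/
open Filter Topology ZeroAtInfty

/-- The image of `[-1, 1] × A` under `(t, u) ↦ t • w + u`. -/
def segmentAdd {X : Type*} [NormedAddCommGroup X] [NormedSpace ℝ X] (w : X) (A : Set X) : Set X :=
  (fun p : ℝ × X => p.1 • w + p.2) '' (Set.Icc (-1) 1 ×ˢ A)

/-- A compact symmetric set contained in the closed ball of radius `c`. -/
structure IsCompactSymmBall {X : Type*} [NormedAddCommGroup X] (c : ℝ) (A : Set X) : Prop where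
  isCompact : IsCompact A
  neg_mem : ∀ u ∈ A, -u ∈ A
  norm_le : ∀ u ∈ A, ‖u‖ ≤ c

theorem eventually_forall_mem_compact_norm_add_lt {X : Type*} [SeminormedAddCommGroup X]
    {x : ℕ → X} {A : Set X} (hA : IsCompact A)
    {r : ℝ} (h : ∀ u ∈ A, ∀ δ > 0, ∀ᶠ n in atTop, ‖x n + u‖ < r + δ) {ε : ℝ} (hε : 0 < ε) :
    ∀ᶠ n in atTop, ∀ u ∈ A, ‖x n + u‖ < r + ε := by
  obtain ⟨t, htA, htf, hcov⟩ := hA.finite_cover_balls (half_pos hε)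
  have := (Set.Finite.eventually_all htf).2 fun u hu => h u (htA hu) (ε / 2) (half_pos hε)
  filter_upwards [this] with n hn u hu
  obtain ⟨v, hv, huv⟩ := Set.mem_iUnion₂.1 (hcov hu)
  have h1 := hn v hv
  rw [Metric.mem_ball, dist_eq_norm] at huv
  have h2 := norm_add_le (x n + v) (u - v)
  rw [show x n + v + (u - v) = x n + u by abel] at h2
  linarith

section Embedding

variable {X : Type*} [NormedAddCommGroup X] [NormedSpace ℝ X]

theorem PropertyM.exists_seq_of_not_propertyK (hM : PropertyM X) (hK : ¬ PropertyK X)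
    {K ε : ℝ} (hK0 : 0 ≤ K) (hK1 : K < 1) (hε : 0 < ε) :
    ∃ x : ℕ → X, Tendsto (fun n => ‖x n‖) atTop (𝓝 1) ∧
      ∀ u : X, ‖u‖ ≤ K → ∀ᶠ n in atTop, ‖x n + u‖ < 1 + ε := by
  unfold PropertyK at hK
  push Not at hK
  obtain ⟨x, y, hx, hx1, hl, hy⟩ := hK K hK0 hK1
  have hbdd : ∀ (z : ℕ → X) (v : X), Tendsto (fun n => ‖z n‖) atTop (𝓝 1) →
      IsBoundedUnder (· ≤ ·) atTop (fun n => ‖z n + v‖) := fun z v hz =>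
    (hz.add_const ‖v‖).isBoundedUnder_le.mono_le (Eventually.of_forall fun n => norm_add_le _ _)
  have hf : ∃ᶠ n in atTop, ‖x n - y‖ < 1 + ε / 2 := by
    refine frequently_lt_of_liminf_lt ?_ (by linarith)
    have := (hbdd x (-y) hx1).isCoboundedUnder_ge
    simpa [sub_eq_add_neg] using this
  obtain ⟨φ, hφ, hφy⟩ := extraction_of_frequently_atTop hf
  have hx1' : Tendsto (fun n => ‖x (φ n)‖) atTop (𝓝 1) := hx1.comp hφ.tendsto_atTop
  refine ⟨x ∘ φ, hx1', fun u hu => ?_⟩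
  have hle := hM (x ∘ φ) (fun f => (hx f).comp hφ.tendsto_atTop) u (-y)
    (by rw [norm_neg]; linarith)
  have hle2 : limsup (fun n => ‖(x ∘ φ) n + -y‖) atTop ≤ 1 + ε / 2 := by
    refine limsup_le_of_le ?_ (Eventually.of_forall fun n => ?_)
    · exact IsBoundedUnder.isCoboundedUnder_le ⟨0, by simp⟩
    · simpa [sub_eq_add_neg] using (hφy n).le
  exact eventually_lt_of_limsup_lt (lt_of_le_of_lt (hle.trans hle2) (by linarith))
    (hbdd (x ∘ φ) u hx1')

theorem norm_smul_add_le_of_abs_le_one {w u : X} {c t : ℝ} (h₁ : ‖w + u‖ ≤ c) (h₂ : ‖w - u‖ ≤ c)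
    (ht : |t| ≤ 1) : ‖t • w + u‖ ≤ c := by
  obtain ⟨ht₁, ht₂⟩ := abs_le.1 ht
  have h : t • w + u = ((1 + t) / 2) • (w + u) - ((1 - t) / 2) • (w - u) := by module
  rw [h]
  refine (norm_sub_le _ _).trans ?_
  rw [norm_smul, norm_smul, Real.norm_of_nonneg (by linarith), Real.norm_of_nonneg (by linarith)]
  nlinarith

theorem PropertyM.exists_isCompactSymmBall_segmentAdd (hM : PropertyM X) (hK : ¬ PropertyK X)
    {A : Set X} {c c' : ℝ} (hc : 1 ≤ c) (hcc' : c < c') (hA : IsCompactSymmBall c A) :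
    ∃ w : X, 9 / 10 ≤ ‖w‖ ∧ IsCompactSymmBall c' (segmentAdd w A) := by
  obtain ⟨s, hcs, hsc⟩ := exists_between hcc'
  have hs : 0 < s := by linarith
  have hε : 0 < c' / s - 1 := by rw [sub_pos, one_lt_div hs]; exact hsc
  obtain ⟨x, hx1, hx⟩ := hM.exists_seq_of_not_propertyK hK (K := c / s)
    (by positivity) ((div_lt_one hs).2 hcs) (half_pos hε)
  have hev := eventually_forall_mem_compact_norm_add_lt (x := x) (A := (fun u => s⁻¹ • u) '' A)
    (r := 1 + (c' / s - 1) / 2)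
    (hA.isCompact.image (continuous_const_smul _)) (by
      rintro _ ⟨u, hu, rfl⟩ δ hδ
      refine (hx (s⁻¹ • u) ?_).mono fun n hn => hn.trans (lt_add_of_pos_right _ hδ)
      rw [norm_smul, norm_inv, Real.norm_of_nonneg hs.le, inv_mul_eq_div]
      gcongr
      exact hA.norm_le u hu) (half_pos hε)
  obtain ⟨n, hn, hn1⟩ :=
    (hev.and (hx1.eventually (lt_mem_nhds (by norm_num : (9 / 10 : ℝ) < 1)))).exists
  have hle : ∀ u ∈ A, ‖s • x n + u‖ ≤ c' := by
    intro u hu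
    have h := hn _ ⟨u, hu, rfl⟩
    have h2 : s • x n + u = s • (x n + s⁻¹ • u) := by
      rw [smul_add, smul_inv_smul₀ hs.ne']
    rw [h2, norm_smul, Real.norm_of_nonneg hs.le, mul_comm, ← le_div_iff₀ hs]
    linarith
  refine ⟨s • x n, ?_, ?_, ?_, ?_⟩
  · rw [norm_smul, Real.norm_of_nonneg hs.le]
    nlinarith
  · exact (isCompact_Icc.prod hA.isCompact).image (by fun_prop)
  · rintro _ ⟨⟨t, u⟩, ⟨ht, hu⟩, rfl⟩
    refine ⟨⟨-t, -u⟩, ⟨?_, hA.neg_mem u hu⟩, ?_⟩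
    · simp only [Set.mem_Icc] at ht ⊢
      constructor <;> linarith
    · simp only
      module
  · rintro _ ⟨⟨t, u⟩, ⟨ht, hu⟩, rfl⟩
    refine norm_smul_add_le_of_abs_le_one (hle u hu) ?_ (abs_le.2 ht)
    simpa [sub_eq_add_neg] using hle (-u) (hA.neg_mem u hu)

theorem PropertyM.exists_seq_norm_sum_le (hM : PropertyM X) (hK : ¬ PropertyK X) :
    ∃ w : ℕ → X, (∀ n, 9 / 10 ≤ ‖w n‖) ∧
      ∀ (n : ℕ) (a : ℕ → ℝ), (∀ i, |a i| ≤ 1) → ‖∑ i ∈ Finset.range n, a i • w i‖ ≤ 3 / 2 := by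
  let c : ℕ → ℝ := fun n => 3 / 2 - (1 / 2) * (1 / 2) ^ n
  have hc1 : ∀ n, 1 ≤ c n := fun n => by
    have : (1 / 2 : ℝ) ^ n ≤ 1 := pow_le_one₀ (by norm_num) (by norm_num)
    simp only [c]; linarith
  have hcc : ∀ n, c n < c (n + 1) := fun n => by
    have : 0 < (1 / 2 : ℝ) ^ n := by positivity
    simp only [c, pow_succ]; linarith
  choose! f hf1 hf2 using fun (n : ℕ) (A : Set X) (hA : IsCompactSymmBall (c n) A) =>
    hM.exists_isCompactSymmBall_segmentAdd hK (hc1 n) (hcc n) hA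
  let S : ℕ → Set X := fun n => Nat.rec {0} (fun n A => segmentAdd (f n A) A) n
  have hS : ∀ n, IsCompactSymmBall (c n) (S n) := by
    intro n
    induction n with
    | zero => exact ⟨isCompact_singleton, by simp [S], by simp [S, c]; norm_num⟩
    | succ n ih => exact hf2 n _ ih
  refine ⟨fun n => f n (S n), fun n => hf1 n _ (hS n), fun n a ha => ?_⟩
  have hmem : ∑ i ∈ Finset.range n, a i • f i (S i) ∈ S n := by
    induction n with
    | zero => simp [S]
    | succ n ih =>
      rw [Finset.sum_range_succ]
      exact ⟨⟨a n, _⟩, ⟨abs_le.1 (ha n), ih⟩, add_comm _ _⟩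
  refine ((hS n).norm_le _ hmem).trans ?_
  have : 0 < (1 / 2 : ℝ) ^ n := by positivity
  simp only [c]; linarith

theorem norm_sum_smul_le_of_norm_sum_range_le {w : ℕ → X} {C : ℝ}
    (hw : ∀ (n : ℕ) (a : ℕ → ℝ), (∀ i, |a i| ≤ 1) → ‖∑ i ∈ Finset.range n, a i • w i‖ ≤ C)
    (s : Finset ℕ) (a : ℕ → ℝ) {R : ℝ} (hR : 0 < R) (ha : ∀ i ∈ s, |a i| ≤ R) :
    ‖∑ i ∈ s, a i • w i‖ ≤ C * R := by
  obtain ⟨n, hn⟩ := s.exists_nat_subset_range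
  have h := hw n (fun i => if i ∈ s then R⁻¹ * a i else 0) fun i => by
    split_ifs with hi
    · rw [abs_mul, abs_inv, abs_of_pos hR, inv_mul_le_iff₀ hR, mul_one]
      exact ha i hi
    · simp
  have h2 : ∑ i ∈ s, a i • w i =
      R • ∑ i ∈ Finset.range n, (if i ∈ s then R⁻¹ * a i else 0) • w i := by
    simp only [ite_smul, zero_smul]
    rw [Finset.sum_ite_mem, Finset.inter_eq_right.2 hn, Finset.smul_sum]
    refine Finset.sum_congr rfl fun i _ => ?_
    rw [smul_smul, mul_inv_cancel_left₀ hR.ne']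
  rw [h2, norm_smul, Real.norm_of_nonneg hR.le, mul_comm]
  gcongr

theorem summable_smul_of_norm_sum_range_le [CompleteSpace X] {w : ℕ → X} {C : ℝ}
    (hw : ∀ (n : ℕ) (a : ℕ → ℝ), (∀ i, |a i| ≤ 1) → ‖∑ i ∈ Finset.range n, a i • w i‖ ≤ C)
    {a : ℕ → ℝ} (ha : Tendsto a cofinite (𝓝 0)) : Summable fun i => a i • w i := by
  have hC : 0 ≤ C := (norm_nonneg _).trans (hw 0 0 (by simp))
  rw [summable_iff_vanishing_norm]
  intro ε hε
  have hR : 0 < ε / (C + 1) := by positivity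
  have hfin : {i | ¬ |a i| < ε / (C + 1)}.Finite := by
    have := Metric.tendsto_nhds.1 ha _ hR
    simpa [Filter.eventually_cofinite] using this
  refine ⟨hfin.toFinset, fun t ht => ?_⟩
  refine (norm_sum_smul_le_of_norm_sum_range_le hw t a hR fun i hi => ?_).trans_lt ?_
  · by_contra h
    exact Finset.disjoint_left.1 ht hi (hfin.mem_toFinset.2 fun h' => h h'.le)
  · rw [mul_div_assoc', div_lt_iff₀ (by positivity)]
    nlinarith

theorem norm_tsum_smul_le_of_norm_sum_range_le [CompleteSpace X] {w : ℕ → X} {C : ℝ}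
    (hw : ∀ (n : ℕ) (a : ℕ → ℝ), (∀ i, |a i| ≤ 1) → ‖∑ i ∈ Finset.range n, a i • w i‖ ≤ C)
    {a : ℕ → ℝ} (ha : Tendsto a cofinite (𝓝 0)) {R : ℝ} (hR : 0 ≤ R) (haR : ∀ i, |a i| ≤ R) :
    ‖∑' i, a i • w i‖ ≤ C * R := by
  have hlim := (summable_smul_of_norm_sum_range_le hw ha).hasSum.norm
  have hle : ∀ R' > R, ‖∑' i, a i • w i‖ ≤ C * R' := fun R' hR' =>
    le_of_tendsto hlim (Eventually.of_forall fun s =>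
      norm_sum_smul_le_of_norm_sum_range_le hw s a (hR.trans_lt hR')
        fun i _ => (haR i).trans hR'.le)
  have hcont : Tendsto (fun R' => C * R') (𝓝[>] R) (𝓝 (C * R)) :=
    ((continuous_const.mul continuous_id).tendsto R).mono_left nhdsWithin_le_nhds
  exact ge_of_tendsto hcont (eventually_mem_nhdsWithin.mono hle)

theorem ZeroAtInftyContinuousMap.tendsto_cofinite (a : C₀(ℕ, ℝ)) :
    Tendsto a cofinite (𝓝 0) := by
  rw [← cocompact_eq_cofinite]
  exact a.zero_at_infty'

theorem ZeroAtInftyContinuousMap.abs_apply_le_norm (a : C₀(ℕ, ℝ)) (i : ℕ) : |a i| ≤ ‖a‖ :=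
  a.toBCF.norm_coe_le_norm i

theorem ZeroAtInftyContinuousMap.norm_le_of_abs_le {a : C₀(ℕ, ℝ)} {R : ℝ} (hR : 0 ≤ R)
    (h : ∀ i, |a i| ≤ R) : ‖a‖ ≤ R :=
  (BoundedContinuousFunction.norm_le hR).2 h

theorem embedsIso_c0_of_norm_sum_range_le [CompleteSpace X] {w : ℕ → X}
    (hw1 : ∀ n, 9 / 10 ≤ ‖w n‖)
    (hw : ∀ (n : ℕ) (a : ℕ → ℝ), (∀ i, |a i| ≤ 1) →
      ‖∑ i ∈ Finset.range n, a i • w i‖ ≤ 3 / 2) :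
    EmbedsIso C₀(ℕ, ℝ) X := by
  have hsum : ∀ a : C₀(ℕ, ℝ), Summable fun i => a i • w i := fun a =>
    summable_smul_of_norm_sum_range_le hw a.tendsto_cofinite
  let L : C₀(ℕ, ℝ) →ₗ[ℝ] X :=
    { toFun := fun a => ∑' i, a i • w i
      map_add' := fun a b => by
        simp only [ZeroAtInftyContinuousMap.add_apply, add_smul]
        exact (hsum a).tsum_add (hsum b)
      map_smul' := fun r a => by
        simp only [ZeroAtInftyContinuousMap.smul_apply, smul_eq_mul, mul_smul, RingHom.id_apply]
        exact (hsum a).tsum_const_smul r }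
  let T : C₀(ℕ, ℝ) →L[ℝ] X := L.mkContinuous (3 / 2) fun a =>
    norm_tsum_smul_le_of_norm_sum_range_le hw a.tendsto_cofinite (norm_nonneg a)
      a.abs_apply_le_norm
  have hlow : ∀ a, 1 / 10 * ‖a‖ ≤ ‖T a‖ := by
    intro a
    have hj : ∀ j, |a j| ≤ (‖T a‖ + 3 / 2 * ‖a‖) / (9 / 5) := by
      intro j
      let e : ℕ → ℝ := Pi.single j (2 * a j)
      have hesum : HasSum (fun i => e i • w i) ((2 * a j) • w j) := by
        have := hasSum_single (f := fun i => e i • w i) j fun i hi => by simp [e, hi]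
        simpa [e] using this
      have he : Tendsto e cofinite (𝓝 0) := by
        refine tendsto_nhds_of_eventually_eq ?_
        rw [Filter.eventually_cofinite]
        refine (Set.finite_singleton j).subset fun i hi => ?_
        by_contra h
        exact hi (Pi.single_eq_of_ne h _)
      have hb : Tendsto (fun i => e i - a i) cofinite (𝓝 0) := by
        simpa using he.sub a.tendsto_cofinite
      have hbound := norm_tsum_smul_le_of_norm_sum_range_le hw hb (norm_nonneg a) fun i => by
        by_cases hi : i = j
        · subst hi
          simp only [e, Pi.single_eq_same]
          rw [show 2 * a i - a i = a i by ring]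
          exact a.abs_apply_le_norm i
        · simp only [e, Pi.single_eq_of_ne hi, zero_sub, abs_neg]
          exact a.abs_apply_le_norm i
      have heq : ∑' i, (e i - a i) • w i = (2 * a j) • w j - T a := by
        simp only [sub_smul]
        exact (hesum.sub (hsum a).hasSum).tsum_eq
      rw [heq] at hbound
      have h1 := norm_le_norm_add_norm_sub' ((2 * a j) • w j) (T a)
      rw [norm_smul, Real.norm_eq_abs, abs_mul, abs_two] at h1
      have h2 := mul_le_mul_of_nonneg_left (hw1 j) (abs_nonneg (a j))
      linarith
    have := ZeroAtInftyContinuousMap.norm_le_of_abs_le (by positivity) hj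
    linarith [norm_nonneg a]
  refine ⟨T, ?_, 1 / 10, by norm_num, hlow⟩
  refine (injective_iff_map_eq_zero T).2 fun a ha => ?_
  have := hlow a
  rw [ha, norm_zero] at this
  exact norm_eq_zero.1 (le_antisymm (by linarith) (norm_nonneg a))

end Embedding

section NonEmbedding

/-- The elements of the unit ball of `c₀` whose first `n` coordinates vanish. -/
def c0TailBall (n : ℕ) : Set C₀(ℕ, ℝ) := {z | ‖z‖ ≤ 1 ∧ ∀ i < n, z i = 0}

theorem zero_mem_c0TailBall (n : ℕ) : (0 : C₀(ℕ, ℝ)) ∈ c0TailBall n := by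
  simp [c0TailBall]

theorem neg_mem_c0TailBall {n : ℕ} {z : C₀(ℕ, ℝ)} (hz : z ∈ c0TailBall n) :
    -z ∈ c0TailBall n :=
  ⟨by rw [norm_neg]; exact hz.1, fun i hi => by simp [hz.2 i hi]⟩

theorem antitone_c0TailBall : Antitone c0TailBall := fun _ _ hmn _ hz =>
  ⟨hz.1, fun i hi => hz.2 i (hi.trans_le hmn)⟩

theorem exists_mem_c0TailBall_norm_eq_one (n : ℕ) : ∃ z ∈ c0TailBall n, ‖z‖ = 1 := by
  let e : C₀(ℕ, ℝ) := ⟨⟨Pi.single n 1, continuous_of_discreteTopology⟩, by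
    rw [cocompact_eq_cofinite]
    refine tendsto_nhds_of_eventually_eq ?_
    rw [Filter.eventually_cofinite]
    refine (Set.finite_singleton n).subset fun i hi => ?_
    by_contra h
    exact hi (Pi.single_eq_of_ne h _)⟩
  have he : ∀ i, e i = (Pi.single n 1 : ℕ → ℝ) i := fun i => rfl
  have hle : ‖e‖ ≤ 1 := ZeroAtInftyContinuousMap.norm_le_of_abs_le zero_le_one fun i => by
    rw [he]
    by_cases h : i = n
    · subst h; simp
    · simp [h]
  refine ⟨e, ⟨hle, fun i hi => ?_⟩, hle.antisymm ?_⟩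
  · rw [he, Pi.single_eq_of_ne hi.ne]
  · simpa [he] using e.abs_apply_le_norm n

theorem eventually_exists_mem_c0TailBall_add_eq {m : ℕ} {z : C₀(ℕ, ℝ)} (hz : z ∈ c0TailBall m)
    {ε : ℝ} (hε : 0 < ε) :
    ∀ᶠ k in atTop, ∀ z' ∈ c0TailBall k, ∃ v ∈ c0TailBall m, z + z' = (1 + ε) • v := by
  have h0 : Tendsto z atTop (𝓝 0) := by
    rw [← Nat.cofinite_eq_atTop]; exact z.tendsto_cofinite
  obtain ⟨N, hN⟩ := eventually_atTop.1 (Metric.tendsto_nhds.1 h0 ε hε)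
  filter_upwards [eventually_ge_atTop (max N m)] with k hk z' hz'
  have hε1 : 0 < 1 + ε := by linarith
  refine ⟨(1 + ε)⁻¹ • (z + z'), ⟨?_, fun i hi => ?_⟩, by rw [smul_inv_smul₀ hε1.ne']⟩
  · rw [norm_smul, norm_inv, Real.norm_of_nonneg hε1.le, inv_mul_le_iff₀ hε1, mul_one]
    refine ZeroAtInftyContinuousMap.norm_le_of_abs_le hε1.le fun i => ?_
    rw [ZeroAtInftyContinuousMap.add_apply]
    rcases lt_or_ge i k with hik | hik
    · rw [hz'.2 i hik, add_zero]
      linarith [z.abs_apply_le_norm i, hz.1]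
    · have h1 := hN i ((le_max_left _ _).trans (hk.trans hik))
      rw [Real.dist_eq, sub_zero] at h1
      linarith [abs_add_le (z i) (z' i), z'.abs_apply_le_norm i, hz'.1]
  · have hik : i < k := hi.trans_le ((le_max_right _ _).trans hk)
    simp [hz.2 i hi, hz'.2 i hik]

variable {X : Type*} [NormedAddCommGroup X] [NormedSpace ℝ X]

theorem ContinuousLinearMap.exists_tail_norms (T : C₀(ℕ, ℝ) →L[ℝ] X) :
    ∃ (σ : ℕ → ℝ) (S : ℝ), Tendsto σ atTop (𝓝 S) ∧
      (∀ n, ∀ z ∈ c0TailBall n, ‖T z‖ ≤ σ n) ∧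
      ∃ z : ℕ → C₀(ℕ, ℝ), (∀ n, z n ∈ c0TailBall n) ∧
        Tendsto (fun n => ‖T (z n)‖) atTop (𝓝 S) := by
  have hbdd : ∀ n, BddAbove ((fun z => ‖T z‖) '' c0TailBall n) := fun n =>
    ⟨‖T‖, by rintro _ ⟨z, hz, rfl⟩; exact T.unit_le_opNorm z hz.1⟩
  have hne : ∀ n, ((fun z => ‖T z‖) '' c0TailBall n).Nonempty := fun n =>
    ⟨_, 0, zero_mem_c0TailBall n, rfl⟩
  let σ : ℕ → ℝ := fun n => sSup ((fun z => ‖T z‖) '' c0TailBall n)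
  have hle : ∀ n, ∀ z ∈ c0TailBall n, ‖T z‖ ≤ σ n := fun n z hz =>
    le_csSup (hbdd n) ⟨z, hz, rfl⟩
  have hanti : Antitone σ := fun m n hmn =>
    csSup_le_csSup (hbdd m) (hne n) (Set.image_mono (antitone_c0TailBall hmn))
  have hσ0 : BddBelow (Set.range σ) := ⟨0, by
    rintro _ ⟨n, rfl⟩
    exact (norm_nonneg _).trans (hle n 0 (zero_mem_c0TailBall n))⟩
  have hlim := tendsto_atTop_ciInf hanti hσ0
  have hex : ∀ n : ℕ, ∃ z ∈ c0TailBall n, σ n - 1 / ((n : ℝ) + 1) < ‖T z‖ := fun n => by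
    obtain ⟨_, ⟨z, hz, rfl⟩, h⟩ := exists_lt_of_lt_csSup (hne n)
      (sub_lt_self (σ n) (Nat.one_div_pos_of_nat (α := ℝ) (n := n)))
    exact ⟨z, hz, h⟩
  choose z hz hzT using hex
  refine ⟨σ, _, hlim, hle, z, hz, ?_⟩
  have h1 : Tendsto (fun n : ℕ => σ n - 1 / ((n : ℝ) + 1)) atTop (𝓝 (⨅ n, σ n)) := by
    simpa using hlim.sub tendsto_one_div_add_atTop_nhds_zero_nat
  exact tendsto_of_tendsto_of_tendsto_of_le_of_le h1 hlim (fun n => (hzT n).le)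
    fun n => hle n _ (hz n)

theorem eventually_norm_add_le_of_mem_c0TailBall {T : C₀(ℕ, ℝ) →L[ℝ] X} {σ : ℕ → ℝ}
    (hσ : ∀ n, ∀ z ∈ c0TailBall n, ‖T z‖ ≤ σ n) {m : ℕ} {v : C₀(ℕ, ℝ)}
    (hv : v ∈ c0TailBall m) {z : ℕ → C₀(ℕ, ℝ)} (hz : ∀ n, z n ∈ c0TailBall n)
    {ε : ℝ} (hε : 0 < ε) : ∀ᶠ k in atTop, ‖T (v + z k)‖ ≤ (1 + ε) * σ m := by
  filter_upwards [eventually_exists_mem_c0TailBall_add_eq hv hε] with k hk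
  obtain ⟨u, hu, h⟩ := hk _ (hz k)
  have hε1 : 0 ≤ 1 + ε := by linarith
  rw [h, map_smul, norm_smul, Real.norm_of_nonneg hε1]
  exact mul_le_mul_of_nonneg_left (hσ m u hu) hε1

theorem weakNull_of_mem_c0TailBall {z : ℕ → C₀(ℕ, ℝ)} (hz : ∀ n, z n ∈ c0TailBall n) :
    WeakNull z := by
  intro f
  obtain ⟨σ, S, hσS, hσ, y, hy, hyS⟩ := f.exists_tail_norms
  have hS : S ≤ 0 := by
    have hsign : ∀ n, ∃ v ∈ c0TailBall n, f v = ‖f (y n)‖ := fun n => by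
      rcases abs_cases (f (y n)) with h | h
      · exact ⟨y n, hy n, h.1.symm⟩
      · exact ⟨-y n, neg_mem_c0TailBall (hy n), by rw [map_neg, ← h.1, Real.norm_eq_abs]⟩
    choose v hv hfv using hsign
    have hvS : Tendsto (fun n => f (v n)) atTop (𝓝 S) := by simpa only [hfv] using hyS
    have h1 : ∀ m, ∀ ε > 0, f (v m) + S ≤ (1 + ε) * σ m := fun m ε hε => by
      refine le_of_tendsto (hvS.const_add (f (v m))) ?_
      filter_upwards [eventually_norm_add_le_of_mem_c0TailBall hσ (hv m) hv hε] with k hk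
      rw [← map_add]
      exact (le_abs_self _).trans hk
    have h2 : ∀ ε > 0, S + S ≤ (1 + ε) * S := fun ε hε =>
      le_of_tendsto_of_tendsto' (hvS.add_const S) (hσS.const_mul (1 + ε)) fun m => h1 m ε hε
    linarith [h2 (1 / 2) (by norm_num)]
  have hS0 : S = 0 := hS.antisymm (ge_of_tendsto' hyS fun n => norm_nonneg _)
  exact squeeze_zero_norm (fun n => hσ n _ (hz n)) (hS0 ▸ hσS)

theorem PropertyM.not_embedsIso_c0_of_propertyK (hM : PropertyM X) (hK : PropertyK X) :
    ¬ EmbedsIso C₀(ℕ, ℝ) X := by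
  rintro ⟨T, -, c, hc, hT⟩
  obtain ⟨K, hK0, hK1, hK⟩ := hK
  obtain ⟨σ, S, hσS, hσ, z, hz, hzS⟩ := T.exists_tail_norms
  have hS : 0 < S := hc.trans_le <| ge_of_tendsto' hσS fun n => by
    obtain ⟨e, he, he1⟩ := exists_mem_c0TailBall_norm_eq_one n
    have := hT e
    rw [he1, mul_one] at this
    exact this.trans (hσ n e he)
  have hweak : WeakNull fun n => T (z n) := fun f =>
    weakNull_of_mem_c0TailBall hz (f.comp T)
  have hlimsup : ∀ u : X, ‖u‖ < S → limsup (fun n => ‖T (z n) + u‖) atTop ≤ S := by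
    intro u hu
    have h1 : ∀ ε > 0, limsup (fun n => ‖T (z n) + u‖) atTop ≤ (1 + ε) * S := by
      intro ε hε
      refine ge_of_tendsto (hσS.const_mul (1 + ε)) ?_
      filter_upwards [hzS.eventually (lt_mem_nhds hu)] with m hm
      refine (hM _ hweak u (T (z m)) hm.le).trans (limsup_le_of_le ?_ ?_)
      · exact IsBoundedUnder.isCoboundedUnder_le ⟨0, by simp⟩
      · filter_upwards [eventually_norm_add_le_of_mem_c0TailBall hσ (hz m) hz hε] with k hk
        rwa [add_comm, ← map_add]
    refine le_of_forall_pos_le_add fun δ hδ => ?_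
    have := h1 (δ / S) (by positivity)
    rwa [add_mul, one_mul, div_mul_cancel₀ _ hS.ne'] at this
  obtain ⟨r, hKr, hr1⟩ := exists_between hK1
  have hr0 : 0 < r := hK0.trans_lt hKr
  obtain ⟨m, hm⟩ := (hzS.eventually (lt_mem_nhds hS)).exists
  let y : X := (r * ‖T (z m)‖⁻¹) • T (z m)
  have hy : ‖y‖ = r := by
    simp only [y]
    rw [norm_smul, norm_mul, norm_inv, norm_norm, Real.norm_of_nonneg hr0.le,
      inv_mul_cancel_right₀ hm.ne']
  have hlim1 : Tendsto (fun n => ‖S⁻¹ • T (z n)‖) atTop (𝓝 1) := by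
    have := hzS.const_mul S⁻¹
    rw [inv_mul_cancel₀ hS.ne'] at this
    simpa [norm_smul, abs_of_pos hS] using this
  have hbdd : IsBoundedUnder (· ≤ ·) atTop fun n => ‖T (z n) + -(S • y)‖ :=
    (hzS.add_const ‖-(S • y)‖).isBoundedUnder_le.mono_le
      (Eventually.of_forall fun n => norm_add_le _ _)
  have hSy : ‖-(S • y)‖ < S := by
    rw [norm_neg, norm_smul, hy, Real.norm_of_nonneg hS.le]
    nlinarith
  have hlim : liminf (fun n => ‖S⁻¹ • T (z n) - y‖) atTop ≤ 1 := by
    refine le_of_forall_pos_le_add fun ε hε => ?_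
    have hev := eventually_lt_of_limsup_lt
      ((hlimsup _ hSy).trans_lt (lt_add_of_pos_right S (mul_pos hS hε))) hbdd
    refine liminf_le_of_frequently_le (Eventually.frequently ?_) ⟨0, by simp⟩
    filter_upwards [hev] with n hn
    have h2 : S⁻¹ • T (z n) - y = S⁻¹ • (T (z n) + -(S • y)) := by
      rw [smul_add, smul_neg, inv_smul_smul₀ hS.ne', sub_eq_add_neg]
    rw [h2, norm_smul, norm_inv, Real.norm_of_nonneg hS.le, inv_mul_le_iff₀ hS]
    linarith
  have := hK (fun n => S⁻¹ • T (z n)) y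
    (fun f => by simpa using (hweak f).const_mul S⁻¹) hlim1 hlim
  linarith

end NonEmbedding

theorem stmt1 (X : Type*) [NormedAddCommGroup X] [NormedSpace ℝ X] [CompleteSpace X]
    [TopologicalSpace.SeparableSpace X]
    (hM : PropertyM X) :
    ¬ EmbedsIso C₀(ℕ, ℝ) X ↔ PropertyK X := by
  refine ⟨fun h => ?_, hM.not_embedsIso_c0_of_propertyK⟩
  by_contra hK
  obtain ⟨w, hw1, hw⟩ := hM.exists_seq_norm_sum_le hK
  exact h (embedsIso_c0_of_norm_sum_range_le hw1 hw)
end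

section
/- Let X be a separable real Banach space with Property(M). If X has a Kadec-Klee norm, then X has Property(K). -/
open Filter Topology ZeroAtInfty

/-- If Property (K) fails, then over any finite set there is an almost normalised vector that
behaves almost like a further coordinate of `c₀`. -/
lemma exists_almost_c0_extension {X : Type*} [NormedAddCommGroup X] [NormedSpace ℝ X]
    (hM : PropertyM X) (hK : ¬ PropertyK X) (F : Set X) (hF : F.Finite) {δ : ℝ} (hδ : 0 < δ) :
    ∃ x : X, |‖x‖ - 1| < δ ∧
      ∀ v ∈ F, ‖v + x‖ ≤ max 1 ‖v‖ + δ ∧ ‖v - x‖ ≤ max 1 ‖v‖ + δ := by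
  obtain ⟨ε, hε, hε1, hεδ⟩ : ∃ ε : ℝ, 0 < ε ∧ ε < 1 ∧ 3 * ε ≤ δ :=
    ⟨min (1 / 2) (δ / 3), by positivity, by
      linarith [min_le_left (1 / 2 : ℝ) (δ / 3)], by linarith [min_le_right (1 / 2 : ℝ) (δ / 3)]⟩
  obtain ⟨x, y, hx, hx1, hxy, hy⟩ : ∃ (x : ℕ → X) (y : X), WeakNull x ∧
      Tendsto (fun n => ‖x n‖) atTop (nhds 1) ∧
      Filter.liminf (fun n => ‖x n - y‖) atTop ≤ 1 ∧ 1 - ε < ‖y‖ := by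
    by_contra! h
    exact hK ⟨1 - ε, by linarith, by linarith, h⟩
  have hbdd (z : ℕ → X) (hz : Tendsto (fun n => ‖z n‖) atTop (nhds 1)) (w : X) :
      IsBoundedUnder (· ≤ ·) atTop (fun n => ‖z n + w‖) := by
    obtain ⟨b, hb⟩ := hz.isBoundedUnder_le
    refine ⟨b + ‖w‖, ?_⟩
    rw [eventually_map] at hb ⊢
    filter_upwards [hb] with n hn
    exact (norm_add_le _ _).trans (by linarith)
  have hfreq : ∃ᶠ n in atTop, ‖x n - y‖ < 1 + ε := by
    refine frequently_lt_of_liminf_lt ?_ (by linarith)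
    simpa [sub_eq_add_neg] using (hbdd x hx1 (-y)).isCoboundedUnder_ge
  obtain ⟨φ, hφ, hφy⟩ := extraction_of_frequently_atTop hfreq
  have hx1φ : Tendsto (fun n => ‖x (φ n)‖) atTop (nhds 1) := hx1.comp hφ.tendsto_atTop
  have hxφ : WeakNull (fun n => x (φ n)) := fun f => (hx f).comp hφ.tendsto_atTop
  have hsmall (w : X) (hw : ‖w‖ ≤ 1 - ε) : ∀ᶠ n in atTop, ‖x (φ n) + w‖ < 1 + 2 * ε := by
    refine eventually_lt_of_limsup_lt ?_ (hbdd _ hx1φ w)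
    have h1 := hM _ hxφ w (-y) (by rw [norm_neg]; linarith)
    have h2 : limsup (fun n => ‖x (φ n) + -y‖) atTop ≤ 1 + ε := by
      refine limsup_le_of_le ?_ (Eventually.of_forall fun n => ?_)
      · exact (isBoundedUnder_of ⟨0, fun n => norm_nonneg _⟩ :
          IsBoundedUnder (· ≥ ·) atTop (fun n => ‖x (φ n) + -y‖)).isCoboundedUnder_le
      · simpa [sub_eq_add_neg] using (hφy n).le
    linarith
  have hext (v : X) : ∀ᶠ n in atTop, ‖v + x (φ n)‖ ≤ max 1 ‖v‖ + δ := by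
    set C := max 1 ‖v‖ with hC
    have hC1 : 1 ≤ C := le_max_left _ _
    have hvC : ‖v‖ ≤ C := le_max_right _ _
    set l := (1 - ε) / C with hl
    have hl0 : 0 ≤ l := div_nonneg (by linarith) (by linarith)
    have hlC : l * C = 1 - ε := div_mul_cancel₀ _ (by linarith)
    have hl1 : l ≤ 1 := by nlinarith
    have hw : ‖l • v‖ ≤ 1 - ε := by
      rw [norm_smul, Real.norm_of_nonneg hl0, ← hlC]
      gcongr
    filter_upwards [hsmall _ hw] with n hn
    have hdec : v + x (φ n) = (x (φ n) + l • v) + (1 - l) • v := by module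
    have hle : ‖(1 - l) • v‖ ≤ C - (1 - ε) := by
      rw [norm_smul, Real.norm_of_nonneg (by linarith), ← hlC]
      nlinarith
    rw [hdec]
    exact (norm_add_le _ _).trans (by linarith)
  have hnorm : ∀ᶠ n in atTop, |‖x (φ n)‖ - 1| < δ := by
    simpa [Real.dist_eq] using hx1φ.eventually (Metric.ball_mem_nhds 1 hδ)
  have hall : ∀ᶠ n in atTop, ∀ v ∈ F,
      ‖v + x (φ n)‖ ≤ max 1 ‖v‖ + δ ∧ ‖v - x (φ n)‖ ≤ max 1 ‖v‖ + δ := by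
    rw [eventually_all_finite hF]
    intro v _
    filter_upwards [hext v, hext (-v)] with n h1 h2
    refine ⟨h1, ?_⟩
    rw [norm_neg] at h2
    rwa [← norm_neg, neg_sub, sub_eq_neg_add]
  obtain ⟨n, h1, h2⟩ := (hnorm.and hall).exists
  exact ⟨x (φ n), h1, h2⟩

/-- A sequence all of whose finite signed sums lie in a common ball is weakly null. -/
lemma weakNull_of_signed_sums_bounded {X : Type*} [NormedAddCommGroup X] [NormedSpace ℝ X]
    (z : ℕ → X) (F : ℕ → Set X) (C : ℝ) (h0 : 0 ∈ F 0)
    (hadd : ∀ n, ∀ v ∈ F n, v + z n ∈ F (n + 1)) (hsub : ∀ n, ∀ v ∈ F n, v - z n ∈ F (n + 1))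
    (hF : ∀ n, ∀ v ∈ F n, ‖v‖ ≤ C) : WeakNull z := by
  intro f
  have hsum (n : ℕ) : ∃ v ∈ F n, f v = ∑ j ∈ Finset.range n, |f (z j)| := by
    induction n with
    | zero => exact ⟨0, h0, by simp⟩
    | succ n ih =>
      obtain ⟨v, hv, hfv⟩ := ih
      rcases le_total 0 (f (z n)) with h | h
      · exact ⟨_, hadd n v hv, by rw [map_add, hfv, Finset.sum_range_succ, abs_of_nonneg h]⟩
      · exact ⟨_, hsub n v hv, by
          rw [map_sub, hfv, Finset.sum_range_succ, abs_of_nonpos h, sub_eq_add_neg]⟩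
  have hsm : Summable fun j => |f (z j)| := by
    refine summable_of_sum_range_le (c := ‖f‖ * C) (fun _ => abs_nonneg _) fun n => ?_
    obtain ⟨v, hv, hfv⟩ := hsum n
    rw [← hfv]
    exact (le_abs_self _).trans ((f.le_opNorm v).trans (by gcongr; exact hF n v hv))
  exact (tendsto_zero_iff_abs_tendsto_zero _).2 hsm.tendsto_atTop_zero

/-- If Property (K) fails in a space with Property (M), then for every vector `u` of the unit ball
there is a weakly null, asymptotically normalised sequence `z` with
`limsup ‖u + z n‖ ≤ 1`. -/
lemma exists_weakNull_of_not_propertyK {X : Type*} [NormedAddCommGroup X] [NormedSpace ℝ X]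
    (hM : PropertyM X) (hK : ¬ PropertyK X) (u : X) (hu : ‖u‖ ≤ 1) :
    ∃ z : ℕ → X, WeakNull z ∧ Tendsto (fun n => ‖z n‖) atTop (nhds 1) ∧
      ∀ n, ‖u + z n‖ ≤ 1 + (1 / 2) ^ (n + 1) := by
  have hstep (n : ℕ) (F : {F : Set X // F.Finite}) :=
    exists_almost_c0_extension hM hK F.1 F.2 (δ := (1 / 2) ^ (n + 1)) (by positivity)
  choose s hs1 hs2 using hstep
  let G : ℕ → {F : Set X // F.Finite} := fun n => Nat.rec ⟨{0, u}, by simp⟩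
    (fun n F => ⟨F.1 ∪ ((fun v => v + s n F) '' F.1 ∪ (fun v => v - s n F) '' F.1),
      F.2.union ((F.2.image _).union (F.2.image _))⟩) n
  have hG0 : (G 0).1 = {0, u} := rfl
  have hG (n : ℕ) : (G (n + 1)).1 = (G n).1 ∪
      ((fun v => v + s n (G n)) '' (G n).1 ∪ (fun v => v - s n (G n)) '' (G n).1) := rfl
  have hGle (n : ℕ) : ∀ v ∈ (G n).1, ‖v‖ ≤ 2 - (1 / 2) ^ n := by
    induction n with
    | zero =>
      rw [hG0]
      rintro v (rfl | rfl) <;> norm_num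
      exact hu
    | succ n ih =>
      have hp : (1 / 2 : ℝ) ^ (n + 1) = (1 / 2) ^ n / 2 := by ring
      have hp0 : (0 : ℝ) < (1 / 2) ^ n := by positivity
      have hp1 : (1 / 2 : ℝ) ^ n ≤ 1 := pow_le_one₀ (by norm_num) (by norm_num)
      have hmax (v : X) (hv : v ∈ (G n).1) : max 1 ‖v‖ ≤ 2 - (1 / 2) ^ n :=
        max_le (by linarith) (ih v hv)
      rw [hG]
      rintro _ (hv | ⟨v, hv, rfl⟩ | ⟨v, hv, rfl⟩)
      · linarith [ih _ hv]
      · linarith [(hs2 n (G n) v hv).1, hmax v hv]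
      · linarith [(hs2 n (G n) v hv).2, hmax v hv]
  have huG (n : ℕ) : u ∈ (G n).1 := by
    induction n with
    | zero => simp [hG0]
    | succ n ih => rw [hG]; exact Or.inl ih
  refine ⟨fun n => s n (G n), ?_, ?_, fun n => ?_⟩
  · refine weakNull_of_signed_sums_bounded _ (fun n => (G n).1) 2 (by simp [hG0])
      (fun n v hv => ?_) (fun n v hv => ?_) fun n v hv => ?_
    · rw [hG]; exact Or.inr (Or.inl ⟨v, hv, rfl⟩)
    · rw [hG]; exact Or.inr (Or.inr ⟨v, hv, rfl⟩)
    · have hp0 : (0 : ℝ) < (1 / 2) ^ n := by positivity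
      linarith [hGle n v hv]
  · rw [tendsto_iff_dist_tendsto_zero]
    refine squeeze_zero (fun _ => dist_nonneg) (fun n => (hs1 n (G n)).le)
      ((tendsto_add_atTop_iff_nat 1).2
        (tendsto_pow_atTop_nhds_zero_of_lt_one (by norm_num) (by norm_num)))
  · simpa [max_eq_left hu] using (hs2 n (G n) u (huG n)).1

theorem stmt4 (X : Type*) [NormedAddCommGroup X] [NormedSpace ℝ X] [CompleteSpace X]
    [TopologicalSpace.SeparableSpace X]
    (hM : PropertyM X) (hKK : KadecKlee X) :
    PropertyK X := by
  by_contra hK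
  obtain ⟨u, hu⟩ : ∃ u : X, ‖u‖ = 1 := by
    have : ∃ y : X, y ≠ 0 := by
      by_contra! h
      exact hK ⟨0, le_rfl, one_pos, fun _ y _ _ _ => by simp [h y]⟩
    obtain ⟨y, hy⟩ := this
    exact ⟨‖y‖⁻¹ • y, by simp [norm_smul, hy]⟩
  obtain ⟨z, hz, hz1, hzu⟩ := exists_weakNull_of_not_propertyK hM hK u hu.le
  have hw (f : X →L[ℝ] ℝ) : Tendsto (fun n => f (u + z n)) atTop (nhds (f u)) := by
    simpa using (hz f).const_add (f u)
  have hn : Tendsto (fun n => ‖u + z n‖) atTop (nhds ‖u‖) := by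
    obtain ⟨f, hf, hfu⟩ := exists_dual_vector ℝ u (by rw [← norm_ne_zero_iff, hu]; norm_num)
    have hupper : Tendsto (fun n : ℕ => (1 : ℝ) + (1 / 2) ^ (n + 1)) atTop (nhds ‖u‖) := by
      rw [hu]
      simpa using ((tendsto_add_atTop_iff_nat 1).2 (tendsto_pow_atTop_nhds_zero_of_lt_one
        (by norm_num : (0 : ℝ) ≤ 1 / 2) (by norm_num))).const_add 1
    have hlower := hw f
    rw [hfu] at hlower
    refine tendsto_of_tendsto_of_tendsto_of_le_of_le hlower hupper (fun n => ?_) hzu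
    simpa [hf] using (le_abs_self _).trans (f.le_opNorm (u + z n))
  have h0 := hKK _ u hw hn
  simp only [add_sub_cancel_left] at h0
  exact one_ne_zero (tendsto_nhds_unique hz1 h0)
end

section
/- Let X be a separable real Banach space whose dual X* has Property(M*). Then c₀ does not embed isomorphically into X* if and only if X* has Property(K*). -/
open Filter Topology ZeroAtInfty

section Embedding

variable {X : Type*} [NormedAddCommGroup X] [NormedSpace ℝ X]

/-- If `X*` has Property (M*) but not Property (K*), any finite set of functionals of norm at most
`C` can be perturbed by `± y`, with `y` of norm nearly one, increasing the bound arbitrarily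
little. -/
lemma exists_functional_norm_add_sub_le (hM : PropertyMStar X) (hK : ¬ PropertyKStar X)
    (S : Finset (X →L[ℝ] ℝ)) {C C' : ℝ} (hC : 1 ≤ C) (hCC' : C < C')
    (hS : ∀ u ∈ S, ‖u‖ ≤ C) :
    ∃ y : X →L[ℝ] ℝ, 7 / 8 ≤ ‖y‖ ∧ ∀ u ∈ S, ‖u + y‖ ≤ C' ∧ ‖u - y‖ ≤ C' := by
  obtain ⟨δ, hδ0, hδ1, hδ2⟩ : ∃ δ : ℝ, 0 < δ ∧ δ ≤ 1 / 16 ∧ 3 * δ ≤ C' - C :=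
    ⟨min (1 / 16) ((C' - C) / 3), by apply lt_min <;> linarith, min_le_left _ _, by
      have := min_le_right (1 / 16 : ℝ) ((C' - C) / 3)
      linarith⟩
  unfold PropertyKStar at hK
  push Not at hK
  obtain ⟨f, g, hf, hf1, hfg, hg⟩ := hK (1 - δ) (by linarith) (by linarith)
  have hfreq : ∃ᶠ n in atTop, ‖f n - g‖ < 1 + δ := by
    refine frequently_lt_of_liminf_lt ?_ (by linarith)
    have hb : Tendsto (fun n => ‖f n‖ + ‖g‖) atTop (nhds (1 + ‖g‖)) := hf1.add_const _
    exact (hb.isBoundedUnder_le.mono_le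
      (Eventually.of_forall fun n => norm_sub_le (f n) g)).isCoboundedUnder_ge
  obtain ⟨φ, hφ, hφg⟩ := extraction_of_frequently_atTop hfreq
  have hfφ1 : Tendsto (fun n => ‖f (φ n)‖) atTop (nhds 1) := hf1.comp hφ.tendsto_atTop
  have small : ∀ v : X →L[ℝ] ℝ, ‖v‖ ≤ 1 - δ → ∀ᶠ n in atTop, ‖f (φ n) + v‖ < 1 + 2 * δ := by
    intro v hv
    have hle : limsup (fun n => ‖f (φ n) + v‖) atTop ≤ 1 + δ := by
      refine (hM (fun n => f (φ n)) (fun x => (hf x).comp hφ.tendsto_atTop) v (-g)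
        (by rw [norm_neg]; linarith)).trans ?_
      refine limsup_le_of_le ?_ (Eventually.of_forall fun n => ?_)
      · exact (isBoundedUnder_of ⟨0, fun n => norm_nonneg _⟩ :
          IsBoundedUnder (· ≥ ·) atTop _).isCoboundedUnder_le
      · rw [← sub_eq_add_neg]
        exact (hφg n).le
    refine eventually_lt_of_limsup_lt (lt_of_le_of_lt hle (by linarith)) ?_
    have hb : Tendsto (fun n => ‖f (φ n)‖ + ‖v‖) atTop (nhds (1 + ‖v‖)) := hfφ1.add_const _
    exact hb.isBoundedUnder_le.mono_le (Eventually.of_forall fun n => norm_add_le _ v)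
  have large : ∀ u : X →L[ℝ] ℝ, ‖u‖ ≤ C → ∀ᶠ n in atTop, ‖f (φ n) + u‖ ≤ C' := by
    intro u hu
    have hC0 : 0 < C := by linarith
    set r := (1 - δ) / C with hr
    have hr0 : 0 ≤ r := div_nonneg (by linarith) hC0.le
    have hr1 : r ≤ 1 := by rw [hr, div_le_one hC0]; linarith
    have hrC : r * C = 1 - δ := div_mul_cancel₀ _ hC0.ne'
    have hru : ‖r • u‖ ≤ 1 - δ := by
      rw [norm_smul, Real.norm_of_nonneg hr0, ← hrC]
      gcongr
    filter_upwards [small _ hru] with n hn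
    have hdecomp : f (φ n) + u = (f (φ n) + r • u) + (1 - r) • u := by module
    have htail : ‖(1 - r) • u‖ ≤ (1 - r) * C := by
      rw [norm_smul, Real.norm_of_nonneg (by linarith)]
      gcongr
    rw [hdecomp]
    refine (norm_add_le _ _).trans ?_
    linarith
  have hall : ∀ᶠ n in atTop, ∀ u ∈ S, ‖f (φ n) + u‖ ≤ C' ∧ ‖f (φ n) + -u‖ ≤ C' :=
    (eventually_all_finset S).2 fun u hu =>
      (large u (hS u hu)).and (large (-u) (by rw [norm_neg]; exact hS u hu))
  obtain ⟨n, hn, hn1⟩ :=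
    (hall.and (hfφ1.eventually (eventually_ge_nhds (by norm_num : (7 / 8 : ℝ) < 1)))).exists
  refine ⟨f (φ n), hn1, fun u hu => ⟨?_, ?_⟩⟩
  · rw [add_comm]
    exact (hn u hu).1
  · rw [norm_sub_rev, sub_eq_add_neg]
    exact (hn u hu).2

/-- If `X*` has Property (M*) but not Property (K*), there is a sequence of functionals of norm
nearly one which is weakly unconditionally Cauchy with constant nearly one. -/
lemma exists_seq_sum_abs_le (hM : PropertyMStar X) (hK : ¬ PropertyKStar X) :
    ∃ y : ℕ → (X →L[ℝ] ℝ), (∀ n, 7 / 8 ≤ ‖y n‖) ∧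
      ∀ n x, ∑ i ∈ Finset.range n, |y i x| ≤ 5 / 4 * ‖x‖ := by
  classical
  let C : ℕ → ℝ := fun k => 5 / 4 - 1 / 4 * (1 / 2) ^ k
  have hC1 : ∀ k, 1 ≤ C k := fun k => by
    have : (1 / 2 : ℝ) ^ k ≤ 1 := pow_le_one₀ (by norm_num) (by norm_num)
    simp only [C]
    linarith
  have hC2 : ∀ k, C k ≤ 5 / 4 := fun k => by
    have : (0 : ℝ) < (1 / 2) ^ k := by positivity
    simp only [C]
    linarith
  have hCC : ∀ k, C k < C (k + 1) := fun k => by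
    have : (0 : ℝ) < (1 / 2) ^ k := by positivity
    simp only [C, pow_succ]
    linarith
  have step : ∀ (k : ℕ) (S : Finset (X →L[ℝ] ℝ)), ∃ y : X →L[ℝ] ℝ, (∀ u ∈ S, ‖u‖ ≤ C k) →
      7 / 8 ≤ ‖y‖ ∧ ∀ u ∈ S, ‖u + y‖ ≤ C (k + 1) ∧ ‖u - y‖ ≤ C (k + 1) := fun k S => by
    by_cases hS : ∀ u ∈ S, ‖u‖ ≤ C k
    · obtain ⟨y, hy⟩ := exists_functional_norm_add_sub_le hM hK S (hC1 k) (hCC k) hS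
      exact ⟨y, fun _ => hy⟩
    · exact ⟨0, fun h => absurd h hS⟩
  choose next hnext using step
  let S : ℕ → Finset (X →L[ℝ] ℝ) := fun n => Nat.rec {0} (fun k T =>
    T.image (fun u => u + next k T) ∪ T.image (fun u => u - next k T)) n
  have hsucc : ∀ k, S (k + 1) = (S k).image (fun u => u + next k (S k)) ∪
      (S k).image (fun u => u - next k (S k)) := fun k => rfl
  have hS : ∀ k, ∀ u ∈ S k, ‖u‖ ≤ C k := by
    intro k
    induction k with
    | zero =>
      intro u hu
      have : u = 0 := Finset.mem_singleton.1 hu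
      rw [this, norm_zero]
      linarith [hC1 0]
    | succ k ih =>
      intro u hu
      rw [hsucc, Finset.mem_union, Finset.mem_image, Finset.mem_image] at hu
      rcases hu with ⟨v, hv, rfl⟩ | ⟨v, hv, rfl⟩
      · exact ((hnext k _ ih).2 v hv).1
      · exact ((hnext k _ ih).2 v hv).2
  refine ⟨fun k => next k (S k), fun k => (hnext k _ (hS k)).1, fun n x => ?_⟩
  have hsum : ∃ u ∈ S n, u x = ∑ i ∈ Finset.range n, |next i (S i) x| := by
    induction n with
    | zero => exact ⟨0, Finset.mem_singleton_self _, by simp⟩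
    | succ n ih =>
      obtain ⟨u, hu, hux⟩ := ih
      rw [Finset.sum_range_succ, ← hux, hsucc]
      rcases le_total 0 (next n (S n) x) with h | h
      · exact ⟨_, Finset.mem_union_left _ (Finset.mem_image_of_mem _ hu), by simp [abs_of_nonneg h]⟩
      · exact ⟨_, Finset.mem_union_right _ (Finset.mem_image_of_mem _ hu), by
          simp [abs_of_nonpos h, sub_eq_add_neg]⟩
  obtain ⟨u, hu, hux⟩ := hsum
  rw [← hux]
  refine (le_abs_self _).trans ((u.le_opNorm x).trans ?_)
  gcongr
  exact (hS n u hu).trans (hC2 n)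

/-- A weakly unconditionally Cauchy sequence of functionals whose norms exceed half of the
unconditionality constant spans a copy of `c₀`. -/
lemma embedsIso_of_sum_abs_le (y : ℕ → (X →L[ℝ] ℝ)) {a C : ℝ} (haC : C < 2 * a)
    (hC : 0 ≤ C) (hy : ∀ n, a ≤ ‖y n‖)
    (hsum : ∀ n x, ∑ i ∈ Finset.range n, |y i x| ≤ C * ‖x‖) :
    EmbedsIso C₀(ℕ, ℝ) (X →L[ℝ] ℝ) := by
  have hcoord : ∀ (t : C₀(ℕ, ℝ)) i, |t i| ≤ ‖t‖ := fun t i => by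
    rw [← ZeroAtInftyContinuousMap.norm_toBCF_eq_norm]
    exact t.toBCF.norm_coe_le_norm i
  have hsy : ∀ x, Summable fun i => |y i x| := fun x =>
    summable_of_sum_range_le (fun i => abs_nonneg _) fun n => hsum n x
  have htsum : ∀ x, ∑' i, |y i x| ≤ C * ‖x‖ := fun x =>
    (hsy x).tsum_le_of_sum_range_le fun n => hsum n x
  have hle : ∀ {s : ℕ → ℝ} {M : ℝ}, (∀ i, |s i| ≤ M) → ∀ x,
      Summable (fun i => s i * y i x) ∧ |∑' i, s i * y i x| ≤ M * C * ‖x‖ := by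
    intro s M hs x
    have hb : ∀ i, ‖s i * y i x‖ ≤ M * |y i x| := fun i => by
      rw [norm_mul, Real.norm_eq_abs, Real.norm_eq_abs]
      gcongr
      exact hs i
    have hM0 : 0 ≤ M := (abs_nonneg _).trans (hs 0)
    refine ⟨Summable.of_norm_bounded ((hsy x).mul_left M) hb, ?_⟩
    refine (tsum_of_norm_bounded ((hsy x).mul_left M).hasSum hb).trans ?_
    rw [tsum_mul_left, mul_assoc]
    gcongr
    exact htsum x
  let L : C₀(ℕ, ℝ) →ₗ[ℝ] X →ₗ[ℝ] ℝ := LinearMap.mk₂ ℝ (fun t x => ∑' i, t i * y i x)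
    (fun t s x => by
      rw [← (hle (hcoord t) x).1.tsum_add (hle (hcoord s) x).1]
      simp only [ZeroAtInftyContinuousMap.add_apply, add_mul])
    (fun r t x => by
      simp only [ZeroAtInftyContinuousMap.smul_apply, smul_eq_mul, mul_assoc, tsum_mul_left])
    (fun t x z => by
      rw [← (hle (hcoord t) x).1.tsum_add (hle (hcoord t) z).1]
      simp only [map_add, mul_add])
    (fun r t x => by
      simp only [map_smul, smul_eq_mul, mul_left_comm _ r, tsum_mul_left])
  have hL : ∀ t x, ‖L t x‖ ≤ C * ‖t‖ * ‖x‖ := fun t x => by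
    rw [mul_comm C]
    exact (hle (hcoord t) x).2
  let T : C₀(ℕ, ℝ) →L[ℝ] X →L[ℝ] ℝ := L.mkContinuous₂ C hL
  have hT : ∀ t x, T t x = ∑' i, t i * y i x := fun t x => rfl
  have hlower : ∀ t, (2 * a - C) * ‖t‖ ≤ ‖T t‖ := by
    intro t
    have hpoint : ∀ j, 2 * |t j| * ‖y j‖ ≤ ‖T t‖ + C * ‖t‖ := by
      intro j
      have hnorm : ‖(2 * t j) • y j‖ ≤ ‖T t‖ + C * ‖t‖ := by
        refine ContinuousLinearMap.opNorm_le_bound _ (by positivity) fun x => ?_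
        have hs : ∀ i, |(fun i => if i = j then - t j else t i) i| ≤ ‖t‖ := fun i => by
          dsimp only
          split_ifs
          · rw [abs_neg]
            exact hcoord t j
          · exact hcoord t i
        have hflip := hle hs x
        have hdiff : T t x - ∑' i, (if i = j then - t j else t i) * y i x = 2 * t j * y j x := by
          rw [hT, ← (hle (hcoord t) x).1.tsum_sub hflip.1, tsum_eq_single j]
          · rw [if_pos rfl]
            ring
          · intro i hi
            rw [if_neg hi, sub_self]
        have hTx : |T t x| ≤ ‖T t‖ * ‖x‖ := (T t).le_opNorm x
        rw [smul_apply, smul_eq_mul, Real.norm_eq_abs, ← hdiff]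
        refine (norm_sub_le (T t x) _).trans ?_
        exact (add_le_add hTx hflip.2).trans (le_of_eq (by ring))
      rwa [norm_smul, norm_mul, Real.norm_eq_abs, Real.norm_eq_abs, abs_two] at hnorm
    have ha : 0 < a := by linarith
    have hsup : ‖t‖ ≤ (‖T t‖ + C * ‖t‖) / (2 * a) := by
      rw [← ZeroAtInftyContinuousMap.norm_toBCF_eq_norm]
      rw [BoundedContinuousFunction.norm_le (by positivity)]
      intro j
      rw [ZeroAtInftyContinuousMap.norm_toBCF_eq_norm, le_div_iff₀ (by positivity)]
      refine le_trans ?_ (hpoint j)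
      have := mul_le_mul_of_nonneg_left (hy j) (abs_nonneg (t j))
      change |t j| * _ ≤ _
      linarith
    rw [le_div_iff₀ (by positivity)] at hsup
    linarith
  refine ⟨T, (injective_iff_map_eq_zero T).2 fun t ht => ?_, 2 * a - C, by linarith, hlower⟩
  have := hlower t
  rw [ht, norm_zero] at this
  exact norm_le_zero_iff.1 (nonpos_of_mul_nonpos_right this (by linarith))

end Embedding

section NonEmbedding

variable {X : Type*} [NormedAddCommGroup X] [NormedSpace ℝ X]

/-- A copy of `c₀` yields a seminormalized sequence all of whose finite sums are bounded. -/
lemma exists_seq_norm_sum_le {E : Type*} [NormedAddCommGroup E] [NormedSpace ℝ E]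
    (h : EmbedsIso C₀(ℕ, ℝ) E) :
    ∃ (x : ℕ → E) (c C : ℝ), 0 < c ∧ (∀ n, c ≤ ‖x n‖) ∧
      ∀ F : Finset ℕ, ‖∑ i ∈ F, x i‖ ≤ C := by
  classical
  obtain ⟨T, -, c, hc, hT⟩ := h
  let e : ℕ → C₀(ℕ, ℝ) := fun n =>
    { toFun := Pi.single n 1
      continuous_toFun := continuous_of_discreteTopology
      zero_at_infty' := by
        rw [cocompact_eq_cofinite]
        refine tendsto_const_nhds.congr' ?_
        filter_upwards [(Set.finite_singleton n).compl_mem_cofinite] with i hi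
        exact (Pi.single_eq_of_ne (M := fun _ => ℝ) hi _).symm }
  have he : ∀ n i, e n i = Pi.single (M := fun _ => ℝ) n 1 i := fun n i => rfl
  refine ⟨fun n => T (e n), c, ‖T‖ * 1, hc, fun n => ?_, fun F => ?_⟩
  · refine le_trans ?_ (hT (e n))
    have h1 : ‖(e n).toBCF n‖ ≤ ‖(e n).toBCF‖ := (e n).toBCF.norm_coe_le_norm n
    have h2 : (e n).toBCF n = 1 := by
      change e n n = 1
      rw [he, Pi.single_eq_same]
    rw [h2, norm_one, ZeroAtInftyContinuousMap.norm_toBCF_eq_norm] at h1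
    exact le_mul_of_one_le_right hc.le h1
  · rw [← map_sum]
    refine (T.le_opNorm _).trans ?_
    gcongr
    rw [← ZeroAtInftyContinuousMap.norm_toBCF_eq_norm,
      BoundedContinuousFunction.norm_le zero_le_one]
    intro j
    have happ : (∑ i ∈ F, e i) j = ∑ i ∈ F, e i j := by
      induction F using Finset.induction_on with
      | empty => rfl
      | insert a s ha ih =>
        rw [Finset.sum_insert ha, Finset.sum_insert ha, ZeroAtInftyContinuousMap.add_apply, ih]
    change ‖(∑ i ∈ F, e i) j‖ ≤ 1
    simp only [happ, he, Finset.sum_pi_single]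
    split_ifs <;> simp

/-- A real series with bounded finite sums is summable. -/
lemma summable_of_abs_sum_le {s : ℕ → ℝ} {C : ℝ} (h : ∀ F : Finset ℕ, |∑ i ∈ F, s i| ≤ C) :
    Summable s := by
  classical
  refine Summable.of_abs (summable_of_sum_le (c := C + C) (fun i => abs_nonneg _) fun F => ?_)
  rw [← Finset.sum_filter_add_sum_filter_not F (fun i => 0 ≤ s i)]
  refine add_le_add ?_ ?_
  · rw [Finset.sum_congr rfl fun i hi => abs_of_nonneg (Finset.mem_filter.1 hi).2]
    exact (le_abs_self _).trans (h _)
  · rw [Finset.sum_congr rfl fun i hi => abs_of_neg (not_le.1 (Finset.mem_filter.1 hi).2),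
      Finset.sum_neg_distrib]
    exact (neg_le_abs _).trans (h _)

/-- A seminormalized sequence with bounded finite sums rules out Property (K*) in the presence of
Property (M*). -/
lemma not_propertyKStar_of_norm_sum_le (hM : PropertyMStar X) {x : ℕ → (X →L[ℝ] ℝ)} {c C : ℝ}
    (hc : 0 < c) (hx : ∀ n, c ≤ ‖x n‖) (hC : ∀ F : Finset ℕ, ‖∑ i ∈ F, x i‖ ≤ C) :
    ¬ PropertyKStar X := by
  classical
  rintro ⟨K, hK0, hK1, hK⟩
  -- `a m` is the supremum of the norms of the finite sums supported in `[m, ∞)`.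
  let b : ℕ → Finset ℕ → (X →L[ℝ] ℝ) := fun m F => ∑ i ∈ F with m ≤ i, x i
  let a : ℕ → ℝ := fun m => ⨆ F, ‖b m F‖
  have hbdd : ∀ m, BddAbove (Set.range fun F => ‖b m F‖) := fun m =>
    ⟨C, Set.forall_mem_range.2 fun F => hC _⟩
  have hba : ∀ m F, ‖b m F‖ ≤ a m := fun m F => le_ciSup (hbdd m) F
  have hanti : Antitone a := by
    intro m k hmk
    refine ciSup_le fun F => ?_
    refine le_trans (le_of_eq ?_) (hba m (F.filter (k ≤ ·)))
    simp only [b]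
    congr 1
    refine Finset.sum_congr ?_ fun _ _ => rfl
    ext i
    simp only [Finset.mem_filter]
    exact ⟨fun h => ⟨h, hmk.trans h.2⟩, fun h => h.1⟩
  have hca : ∀ m, c ≤ a m := fun m => by
    refine (hx m).trans (le_trans (le_of_eq ?_) (hba m {m}))
    simp [b, Finset.filter_singleton]
  have hlim := tendsto_atTop_ciInf hanti ⟨c, Set.forall_mem_range.2 hca⟩
  set L := ⨅ m, a m
  have hL : 0 < L := hc.trans_le (le_ciInf hca)
  have hchoose : ∀ m : ℕ, ∃ F, a m - 1 / ((m : ℝ) + 1) < ‖b m F‖ := fun m =>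
    exists_lt_of_lt_ciSup (sub_lt_self _ Nat.one_div_pos_of_nat)
  choose F hF using hchoose
  have hnorm : Tendsto (fun m => ‖b m (F m)‖) atTop (nhds L) := by
    refine tendsto_of_tendsto_of_tendsto_of_le_of_le ?_ hlim (fun m => (hF m).le)
      fun m => hba m _
    simpa using hlim.sub tendsto_one_div_add_atTop_nhds_zero_nat
  let f : ℕ → (X →L[ℝ] ℝ) := fun m => L⁻¹ • b m (F m)
  have hfnorm : ∀ m, ‖f m‖ = L⁻¹ * ‖b m (F m)‖ := fun m => by
    rw [norm_smul, Real.norm_of_nonneg (inv_nonneg.2 hL.le)]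
  have hf1 : Tendsto (fun m => ‖f m‖) atTop (nhds 1) := by
    simp only [hfnorm]
    simpa [inv_mul_cancel₀ hL.ne'] using hnorm.const_mul L⁻¹
  have hfnull : WeakStarNull f := by
    intro z
    have hsz : Summable fun i => x i z := by
      refine summable_of_abs_sum_le (C := C * ‖z‖) fun G => ?_
      rw [← sum_apply]
      refine ((∑ i ∈ G, x i).le_opNorm z).trans ?_
      gcongr
      exact hC G
    have hb : Tendsto (fun m => b m (F m) z) atTop (nhds 0) := by
      refine tendsto_def.2 fun s hs => ?_
      obtain ⟨G, hG⟩ := summable_iff_vanishing.1 hsz s hs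
      filter_upwards [eventually_gt_atTop (G.sup id)] with m hm
      simp only [Set.mem_preimage, b, sum_apply]
      refine hG _ (Finset.disjoint_left.2 fun i hi hiG => ?_)
      exact absurd ((Finset.mem_filter.1 hi).2.trans (Finset.le_sup (f := id) hiG))
        (not_le.2 hm)
    simpa [f] using hb.const_mul L⁻¹
  have hadd : ∀ m, ∀ᶠ k in atTop, ‖f k + f m‖ ≤ L⁻¹ * a m := by
    intro m
    filter_upwards [eventually_gt_atTop ((F m).sup id), eventually_ge_atTop m] with k hk hmk
    have hsum : b k (F k) + b m (F m) =
        b m ((F k).filter (k ≤ ·) ∪ (F m).filter (m ≤ ·)) := by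
      simp only [b]
      rw [← Finset.sum_union]
      · refine Finset.sum_congr ?_ fun _ _ => rfl
        ext i
        simp only [Finset.mem_filter, Finset.mem_union]
        grind
      · refine Finset.disjoint_left.2 fun i hi him => ?_
        exact absurd ((Finset.mem_filter.1 hi).2.trans
          (Finset.le_sup (f := id) (Finset.mem_filter.1 him).1)) (not_le.2 hk)
    rw [← smul_add, hsum, norm_smul, Real.norm_of_nonneg (inv_nonneg.2 hL.le)]
    gcongr
    exact hba m _
  have hcob : ∀ v : X →L[ℝ] ℝ, IsCoboundedUnder (· ≤ ·) atTop fun n => ‖f n + v‖ := fun v =>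
    (isBoundedUnder_of ⟨0, fun n => norm_nonneg _⟩ :
      IsBoundedUnder (· ≥ ·) atTop _).isCoboundedUnder_le
  have hflat : ∀ v : X →L[ℝ] ℝ, ‖v‖ < 1 → limsup (fun n => ‖f n + v‖) atTop ≤ 1 := by
    intro v hv
    have hL1 : Tendsto (fun m => L⁻¹ * a m) atTop (nhds 1) := by
      simpa [inv_mul_cancel₀ hL.ne'] using hlim.const_mul L⁻¹
    refine ge_of_tendsto hL1 ?_
    filter_upwards [hf1.eventually (eventually_gt_nhds hv)] with m hm
    exact (hM f hfnull v (f m) hm.le).trans (limsup_le_of_le (hcob _) (hadd m))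
  set g : X →L[ℝ] ℝ := ((K + 1) / 2 / ‖x 0‖) • x 0
  have hx0 : 0 < ‖x 0‖ := hc.trans_le (hx 0)
  have hg : ‖g‖ = (K + 1) / 2 := by
    rw [norm_smul, Real.norm_of_nonneg (by positivity), div_mul_cancel₀ _ hx0.ne']
  have hgK : ‖g‖ ≤ K := by
    refine hK f g hfnull hf1 ?_
    simp only [sub_eq_add_neg]
    refine le_trans (liminf_le_limsup ?_ ?_) (hflat (-g) (by rw [norm_neg]; linarith))
    · exact (hf1.add_const ‖-g‖).isBoundedUnder_le.mono_le
        (Eventually.of_forall fun n => norm_add_le _ _)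
    · exact isBoundedUnder_of ⟨0, fun n => norm_nonneg _⟩
  linarith

end NonEmbedding

theorem stmt6 (X : Type*) [NormedAddCommGroup X] [NormedSpace ℝ X] [CompleteSpace X]
    [TopologicalSpace.SeparableSpace X]
    (hM : PropertyMStar X) :
    ¬ EmbedsIso C₀(ℕ, ℝ) (X →L[ℝ] ℝ) ↔ PropertyKStar X := by
  refine ⟨fun h => ?_, fun hK h => ?_⟩
  · by_contra hK
    obtain ⟨y, hy, hsum⟩ := exists_seq_sum_abs_le hM hK
    exact h (embedsIso_of_sum_abs_le y (by norm_num) (by norm_num) hy hsum)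
  · obtain ⟨x, c, C, hc, hx, hC⟩ := exists_seq_norm_sum_le h
    exact not_propertyKStar_of_norm_sum_le hM hc hx hC hK
end

section
/- Let X be a separable real Banach space whose dual X* has Property(M*). If X* has a weak* Kadec-Klee norm, then X* has Property(K*). -/
open Filter Topology ZeroAtInfty

/-- A norm-bounded sequence of functionals tending to zero on a dense set is weak-star null. -/
lemma weakStarNull_of_denseRange {E ι : Type*} [NormedAddCommGroup E] [NormedSpace ℝ E]
    {f : ℕ → (E →L[ℝ] ℝ)} {C : ℝ} (hC : ∀ n, ‖f n‖ ≤ C) {d : ι → E} (hd : DenseRange d)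
    (h : ∀ i, Tendsto (fun n => f n (d i)) atTop (nhds 0)) : WeakStarNull f := by
  intro x
  have hC0 : 0 ≤ C := (norm_nonneg _).trans (hC 0)
  rw [Metric.tendsto_nhds]
  intro ε hε
  obtain ⟨i, hi⟩ := hd.exists_dist_lt x (show 0 < ε / (2 * (C + 1)) by positivity)
  filter_upwards [Metric.tendsto_nhds.1 (h i) (ε / 2) (by positivity)] with n hn
  rw [dist_zero_right] at hn ⊢
  have h1 : ‖f n (x - d i)‖ ≤ C * ‖x - d i‖ := (f n).le_of_opNorm_le (hC n) _
  have h2 : C * ‖x - d i‖ ≤ ε / 2 := by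
    rw [dist_eq_norm, lt_div_iff₀ (by positivity)] at hi
    nlinarith [norm_nonneg (x - d i)]
  calc ‖f n x‖ = ‖f n (x - d i) + f n (d i)‖ := by rw [map_sub, sub_add_cancel]
    _ ≤ ‖f n (x - d i)‖ + ‖f n (d i)‖ := norm_add_le _ _
    _ < ε := by linarith

/-- The dual norm is weak-star sequentially lower semicontinuous. -/
lemma eventually_lt_norm_add_of_weakStarNull {E : Type*} [NormedAddCommGroup E] [NormedSpace ℝ E]
    {f : ℕ → (E →L[ℝ] ℝ)} (hf : WeakStarNull f) (u : E →L[ℝ] ℝ) {r : ℝ} (hr : r < ‖u‖) :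
    ∀ᶠ n in atTop, r < ‖f n + u‖ := by
  obtain ⟨x, hx, hux⟩ := u.exists_lt_apply_of_lt_opNorm hr
  have h : Tendsto (fun n => ‖(f n + u) x‖) atTop (nhds ‖u x‖) := by
    simpa using ((hf x).add_const (u x)).norm
  filter_upwards [h.eventually_const_lt hux] with n hn
  exact hn.trans_le ((f n + u).unit_le_opNorm x hx.le)

/-- Under Property (M*), a translate by `g` that does not increase the asymptotic norm can be
replaced by any translate of no larger norm, along a subsequence. -/
lemma PropertyMStar.frequently_norm_add_lt {E : Type*} [NormedAddCommGroup E] [NormedSpace ℝ E]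
    (hM : PropertyMStar E) {f : ℕ → (E →L[ℝ] ℝ)} {g u : E →L[ℝ] ℝ} (hf : WeakStarNull f)
    (hf1 : Tendsto (fun n => ‖f n‖) atTop (nhds 1)) {r : ℝ}
    (hg : Filter.liminf (fun n => ‖f n - g‖) atTop < r) (hu : ‖u‖ ≤ ‖g‖) :
    ∃ᶠ n in atTop, ‖f n + u‖ < r := by
  have hbdd : ∀ v : E →L[ℝ] ℝ, IsBoundedUnder (· ≤ ·) atTop (fun n => ‖f n + v‖) := fun v =>
    (hf1.add_const ‖v‖).isBoundedUnder_le.mono_le (Eventually.of_forall fun n => norm_add_le _ _)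
  obtain ⟨s, hs, hsr⟩ := exists_between hg
  have hfreq : ∃ᶠ n in atTop, ‖f n - g‖ < s := by
    refine frequently_lt_of_liminf_lt ?_ hs
    simpa only [sub_eq_add_neg] using (hbdd (-g)).isCoboundedUnder_ge
  obtain ⟨φ, hφ, hφs⟩ := extraction_of_frequently_atTop hfreq
  have hle := hM (fun n => f (φ n)) (fun x => (hf x).comp hφ.tendsto_atTop) u (-g)
    (by rwa [norm_neg])
  have hlim : Filter.limsup (fun n => ‖f (φ n) + -g‖) atTop ≤ s := by
    refine limsup_le_of_le ?_ (Eventually.of_forall fun n => ?_)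
    · exact IsBoundedUnder.isCoboundedUnder_le
        (isBoundedUnder_of ⟨0, fun n => norm_nonneg _⟩)
    · rw [← sub_eq_add_neg]
      exact (hφs n).le
  have hev : ∀ᶠ n in atTop, ‖f (φ n) + u‖ < r :=
    eventually_lt_of_limsup_lt ((hle.trans hlim).trans_lt hsr)
      (hφ.tendsto_atTop.isBoundedUnder_comp (hbdd u))
  exact hφ.tendsto_atTop.frequently hev.frequently

/-- If Property (K*) fails under Property (M*), then every weak-star neighbourhood of zero contains
functionals of norm close to one whose translates by `u` have norm almost at most one. -/
lemma PropertyMStar.exists_norm_add_lt {E : Type*} [NormedAddCommGroup E] [NormedSpace ℝ E]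
    (hM : PropertyMStar E) (hK : ¬ PropertyKStar E) {u : E →L[ℝ] ℝ} (hu : ‖u‖ = 1)
    (s : Finset E) {ε : ℝ} (hε : 0 < ε) :
    ∃ h : E →L[ℝ] ℝ, |‖h‖ - 1| < ε ∧ ‖h + u‖ < 1 + ε ∧ ∀ x ∈ s, |h x| < ε := by
  unfold PropertyKStar at hK
  push Not at hK
  set δ := min (ε / 2) 1 with hδ
  have hδ0 : 0 < δ := lt_min (by positivity) one_pos
  have hδ1 : δ ≤ 1 := min_le_right _ _
  have hδε : δ ≤ ε / 2 := min_le_left _ _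
  obtain ⟨f, g, hf, hf1, hfg, hg⟩ := hK (1 - δ) (by linarith) (by linarith)
  have hnorm : ‖(1 - δ) • u‖ = 1 - δ := by
    rw [norm_smul, hu, mul_one, Real.norm_of_nonneg (by linarith)]
  have hfreq := hM.frequently_norm_add_lt (r := 1 + ε / 2) hf hf1 (by linarith)
    (hnorm.le.trans hg.le)
  have hev1 : ∀ᶠ n in atTop, |‖f n‖ - 1| < ε := by
    simpa only [Real.dist_eq] using Metric.tendsto_nhds.1 hf1 ε hε
  have hev2 : ∀ᶠ n in atTop, ∀ x ∈ s, |f n x| < ε := by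
    rw [Filter.eventually_all_finset]
    intro x _
    simpa only [Real.dist_eq, sub_zero] using Metric.tendsto_nhds.1 (hf x) ε hε
  obtain ⟨n, hn, hn1, hn2⟩ := (hfreq.and_eventually (hev1.and hev2)).exists
  refine ⟨f n, hn1, ?_, hn2⟩
  have hsmul : ‖δ • u‖ = δ := by rw [norm_smul, hu, mul_one, Real.norm_of_nonneg hδ0.le]
  calc ‖f n + u‖ = ‖(f n + (1 - δ) • u) + δ • u‖ := by
        congr 1
        module
    _ ≤ ‖f n + (1 - δ) • u‖ + ‖δ • u‖ := norm_add_le _ _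
    _ < 1 + ε := by linarith

theorem stmt7 (X : Type*) [NormedAddCommGroup X] [NormedSpace ℝ X] [CompleteSpace X]
    [TopologicalSpace.SeparableSpace X]
    (hM : PropertyMStar X) (hKK : WeakStarKadecKlee X) :
    PropertyKStar X := by
  by_contra hK
  obtain ⟨u, hu⟩ : ∃ u : X →L[ℝ] ℝ, ‖u‖ = 1 := by
    have hK' := hK
    unfold PropertyKStar at hK'
    push Not at hK'
    obtain ⟨-, g, -, -, -, hg⟩ := hK' 0 le_rfl one_pos
    exact ⟨‖g‖⁻¹ • g, by rw [norm_smul, norm_inv, norm_norm, inv_mul_cancel₀ hg.ne']⟩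
  classical
  choose h h1 h2 h3 using fun k : ℕ => hM.exists_norm_add_lt hK hu
    ((Finset.range k).image (TopologicalSpace.denseSeq X)) (Nat.one_div_pos_of_nat (α := ℝ) (n := k))
  have hε := tendsto_one_div_add_atTop_nhds_zero_nat (𝕜 := ℝ)
  have hnull : WeakStarNull h := by
    refine weakStarNull_of_denseRange (C := 2) (fun k => ?_)
      (TopologicalSpace.denseRange_denseSeq X) fun i => ?_
    · have hk : 1 / ((k : ℝ) + 1) ≤ 1 := by
        rw [div_le_one (by positivity)]
        linarith [k.cast_nonneg (α := ℝ)]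
      linarith [(abs_lt.1 (h1 k)).2]
    · refine squeeze_zero_norm' ?_ hε
      filter_upwards [eventually_gt_atTop i] with k hk
      exact (h3 k _ (Finset.mem_image_of_mem _ (Finset.mem_range.2 hk))).le
  have hnorm : Tendsto (fun k => ‖h k‖) atTop (nhds 1) := by
    rw [tendsto_iff_norm_sub_tendsto_zero]
    exact squeeze_zero (fun _ => norm_nonneg _) (fun k => (h1 k).le) hε
  have hadd : Tendsto (fun k => ‖h k + u‖) atTop (nhds ‖u‖) := by
    refine tendsto_order.2 ⟨fun r hr => eventually_lt_norm_add_of_weakStarNull hnull u hr,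
      fun r hr => ?_⟩
    have hε1 := hε.const_add 1
    rw [add_zero] at hε1
    filter_upwards [hε1.eventually_lt_const (hu ▸ hr)] with k hk
    exact (h2 k).trans hk
  have hzero := hKK (fun k => h k + u) u
    (fun x => by simpa using (hnull x).add_const (u x)) hadd
  simp only [add_sub_cancel_right] at hzero
  exact one_ne_zero (tendsto_nhds_unique hnorm hzero)
end
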